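/- arXiv:1810.02044 — 9 statements merged into one kernel-verified Lean document; each statement's English description precedes it below -/
import Mathlib

section
/- Let Q be a symmetric n×n real matrix, q ∈ ℝⁿ, f(x) = ½xᵀQx + qᵀx, and C = {x ∈ ℝⁿ : Ax ≥ b} nonempty. Fix ρ > ‖Q‖ (operator norm; note this implies ρ > −λ₁(Q)). Suppose x* ∈ C is a locally unique solution of min{f(x) : x ∈ C}, i.e., there is ε₀ > 0 with f(x) > f(x*) for all x ∈ (C ∩ B(x*, ε₀)) \ {x*}. Then for every ε > 0 there exists δ > 0 such that whenever x⁰ ∈ C ∩ B(x*, δ) and {xᵏ} is defined by letting x^{k+1} be the unique minimizer over C of x ↦ f(x) + (ρ/2)‖x − xᵏ‖², one has xᵏ ∈ C ∩ B(x*, ε) for all k ≥ 0 and xᵏ → x* as k → ∞. -/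
open RealInnerProductSpace Filter Topology

section ProximalQuadratic

variable {E : Type*} [NormedAddCommGroup E] [InnerProductSpace ℝ E]

/-- The quadratic function with Hessian `T` and linear part `q`. -/
noncomputable def quadFun (T : E →L[ℝ] E) (q x : E) : ℝ := (1/2) * ⟪T x, x⟫ + ⟪q, x⟫

/-- Stationary points of `quadFun T q` on `C`, in variational inequality form. -/
def IsStationaryOn (T : E →L[ℝ] E) (q : E) (C : Set E) (z : E) : Prop :=
  z ∈ C ∧ ∀ w ∈ C, 0 ≤ ⟪T z + q, w - z⟫

/-- `y` minimizes `w ↦ quadFun T q w + ρ/2 * ‖w - u‖ ^ 2` over `C`. -/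
def IsProxPoint (T : E →L[ℝ] E) (q : E) (C : Set E) (ρ : ℝ) (u y : E) : Prop :=
  y ∈ C ∧ ∀ w ∈ C, quadFun T q y + ρ/2 * ‖y - u‖^2 ≤ quadFun T q w + ρ/2 * ‖w - u‖^2

lemma quadFun_continuous (T : E →L[ℝ] E) (q : E) : Continuous (quadFun T q) := by
  unfold quadFun
  fun_prop

lemma quadFun_add {T : E →L[ℝ] E} (hT : ∀ x y, ⟪T x, y⟫ = ⟪x, T y⟫) (q y d : E) :
    quadFun T q (y + d) = quadFun T q y + ⟪T y + q, d⟫ + (1/2) * ⟪T d, d⟫ := by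
  have h : ⟪T d, y⟫ = ⟪T y, d⟫ := by rw [hT, real_inner_comm]
  simp only [quadFun, map_add, inner_add_left, inner_add_right, h]
  ring

lemma quadFun_add_smul {T : E →L[ℝ] E} (hT : ∀ x y, ⟪T x, y⟫ = ⟪x, T y⟫) (q y d : E) (t : ℝ) :
    quadFun T q (y + t • d) =
      quadFun T q y + t * ⟪T y + q, d⟫ + t ^ 2 * ((1/2) * ⟪T d, d⟫) := by
  rw [quadFun_add hT]
  simp only [map_smul, real_inner_smul_left, real_inner_smul_right]
  ring

lemma nonneg_of_eventually_nonneg_quadratic {a c : ℝ}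
    (h : ∀ᶠ t : ℝ in 𝓝[>] 0, 0 ≤ t * a + t ^ 2 * c) : 0 ≤ a := by
  have hlim : Tendsto (fun t : ℝ => a + t * c) (𝓝[>] 0) (𝓝 a) := by
    have : Continuous (fun t : ℝ => a + t * c) := by fun_prop
    simpa using (this.tendsto 0).mono_left nhdsWithin_le_nhds
  refine ge_of_tendsto hlim ?_
  filter_upwards [h, self_mem_nhdsWithin] with t ht hpos
  have hpos : 0 < t := hpos
  refine nonneg_of_mul_nonneg_right (a := t) ?_ hpos
  linarith

lemma eventually_add_smul_mem {C : Set E} (hconv : Convex ℝ C) {y w : E} (hy : y ∈ C)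
    (hw : w ∈ C) : ∀ᶠ t : ℝ in 𝓝[>] 0, y + t • (w - y) ∈ C := by
  filter_upwards [Ioo_mem_nhdsGT (zero_lt_one' ℝ)] with t ht
  exact hconv.add_smul_sub_mem hy hw ⟨ht.1.le, ht.2.le⟩

lemma isStationaryOn_of_local_min {T : E →L[ℝ] E} (hT : ∀ x y, ⟪T x, y⟫ = ⟪x, T y⟫) {q : E}
    {C : Set E} (hconv : Convex ℝ C) {z : E} (hz : z ∈ C) {r : ℝ} (hr : 0 < r)
    (hmin : ∀ w ∈ C ∩ Metric.ball z r, quadFun T q z ≤ quadFun T q w) :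
    IsStationaryOn T q C z := by
  refine ⟨hz, fun w hw => ?_⟩
  refine nonneg_of_eventually_nonneg_quadratic (c := (1/2) * ⟪T (w - z), w - z⟫) ?_
  have hcont : Tendsto (fun t : ℝ => z + t • (w - z)) (𝓝[>] 0) (𝓝 z) := by
    have : Continuous (fun t : ℝ => z + t • (w - z)) := by fun_prop
    simpa using (this.tendsto 0).mono_left nhdsWithin_le_nhds
  filter_upwards [eventually_add_smul_mem hconv hz hw,
    hcont.eventually (Metric.ball_mem_nhds z hr)] with t ht hb
  have := hmin _ ⟨ht, hb⟩
  rw [quadFun_add_smul hT] at this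
  linarith

lemma IsProxPoint.variational {T : E →L[ℝ] E} (hT : ∀ x y, ⟪T x, y⟫ = ⟪x, T y⟫) {q : E}
    {C : Set E} (hconv : Convex ℝ C) {ρ : ℝ} {u y : E} (h : IsProxPoint T q C ρ u y) :
    ∀ w ∈ C, 0 ≤ ⟪T y + q, w - y⟫ + ρ * ⟪y - u, w - y⟫ := by
  intro w hw
  refine nonneg_of_eventually_nonneg_quadratic
    (c := (1/2) * ⟪T (w - y), w - y⟫ + ρ / 2 * ‖w - y‖ ^ 2) ?_
  filter_upwards [eventually_add_smul_mem hconv h.1 hw] with t ht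
  have hmin := h.2 _ ht
  have hsplit : y + t • (w - y) - u = (y - u) + t • (w - y) := by abel
  rw [quadFun_add_smul hT, hsplit, norm_add_sq_real, norm_smul, mul_pow, Real.norm_eq_abs,
    sq_abs, real_inner_smul_right] at hmin
  linarith

lemma IsProxPoint.isStationaryOn {T : E →L[ℝ] E} (hT : ∀ x y, ⟪T x, y⟫ = ⟪x, T y⟫) {q : E}
    {C : Set E} (hconv : Convex ℝ C) {ρ : ℝ} {z : E} (h : IsProxPoint T q C ρ z z) :
    IsStationaryOn T q C z :=
  ⟨h.1, fun w hw => by simpa using h.variational hT hconv w hw⟩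

lemma IsProxPoint.norm_sub_le {T : E →L[ℝ] E} (hT : ∀ x y, ⟪T x, y⟫ = ⟪x, T y⟫) {q : E}
    {C : Set E} (hconv : Convex ℝ C) {ρ : ℝ} (hρ : ‖T‖ < ρ) {u y z : E}
    (h : IsProxPoint T q C ρ u y) (hz : IsStationaryOn T q C z) :
    (ρ - ‖T‖) * ‖y - z‖ ≤ ρ * ‖u - z‖ := by
  have hρ0 : 0 < ρ := (norm_nonneg T).trans_lt hρ
  have h1 := h.variational hT hconv z hz.1
  have h2 := hz.2 y h.1
  have hneg : z - y = -(y - z) := by abel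
  have hTy : T y + q = T (y - z) + (T z + q) := by rw [map_sub]; abel
  have hyu : y - u = (y - z) - (u - z) := by abel
  rw [hneg, hTy, hyu, inner_neg_right, inner_neg_right, inner_add_left, inner_sub_left,
    real_inner_self_eq_norm_sq] at h1
  have h3 : -(‖T‖ * ‖y - z‖ * ‖y - z‖) ≤ ⟪T (y - z), y - z⟫ := by
    refine (abs_le.mp ((abs_real_inner_le_norm _ _).trans ?_)).1
    exact mul_le_mul_of_nonneg_right (T.le_opNorm _) (norm_nonneg _)
  have h4 : ρ * ⟪u - z, y - z⟫ ≤ ρ * (‖u - z‖ * ‖y - z‖) :=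
    mul_le_mul_of_nonneg_left (real_inner_le_norm _ _) hρ0.le
  rcases (norm_nonneg (y - z)).eq_or_lt with h0 | hpos
  · rw [← h0]
    simp only [mul_zero]
    positivity
  · refine le_of_mul_le_mul_right ?_ hpos
    nlinarith

lemma IsProxPoint.quadFun_le {T : E →L[ℝ] E} {q : E} {C : Set E} {ρ : ℝ} (hρ : 0 < ρ) {u y : E}
    (h : IsProxPoint T q C ρ u y) (hu : u ∈ C) : quadFun T q y ≤ quadFun T q u := by
  have h1 := h.2 u hu
  have h2 : 0 ≤ ρ / 2 * ‖y - u‖ ^ 2 := by positivity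
  simp only [sub_self, norm_zero] at h1
  linarith

lemma IsStationaryOn.inner_eq_zero {ι : Type*} [Finite ι] {T : E →L[ℝ] E} {q : E}
    {a : ι → E →ₗ[ℝ] ℝ} {b : ι → ℝ} {z w : E}
    (hz : IsStationaryOn T q {x | ∀ i, b i ≤ a i x} z) (hw : ∀ i, b i ≤ a i w)
    (hact : ∀ i, a i z = b i → a i w = b i) : ⟪T z + q, w - z⟫ = 0 := by
  have hfeas : ∀ᶠ t : ℝ in 𝓝[>] 0, ∀ i, b i ≤ a i (z - t • (w - z)) := by
    rw [eventually_all]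
    intro i
    simp only [map_sub, map_smul, smul_eq_mul]
    rcases (hz.1 i).eq_or_lt with h | h
    · rw [hact i h.symm, ← h]
      simp
    · have hc : Continuous (fun t : ℝ => a i z - t * (a i w - a i z)) := by fun_prop
      have hlim := (hc.tendsto 0).mono_left (nhdsWithin_le_nhds (s := Set.Ioi 0))
      simp only [zero_mul, sub_zero] at hlim
      exact (hlim.eventually (lt_mem_nhds h)).mono fun _ ht => ht.le
  obtain ⟨t, ht, hpos⟩ := (hfeas.and self_mem_nhdsWithin).exists
  have hpos : 0 < t := hpos
  have h1 := hz.2 w hw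
  have h2 := hz.2 _ ht
  have hd : z - t • (w - z) - z = -(t • (w - z)) := by abel
  rw [hd, inner_neg_right, real_inner_smul_right] at h2
  nlinarith

/-- A quadratic function takes finitely many values on its stationary points on a polyhedron. -/
lemma finite_quadFun_image_isStationaryOn {ι : Type*} [Finite ι] {T : E →L[ℝ] E}
    (hT : ∀ x y, ⟪T x, y⟫ = ⟪x, T y⟫) (q : E) (a : ι → E →ₗ[ℝ] ℝ) (b : ι → ℝ) :
    (quadFun T q '' {z | IsStationaryOn T q {x | ∀ i, b i ≤ a i x} z}).Finite := by
  classical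
  set S := {z | IsStationaryOn T q {x | ∀ i, b i ≤ a i x} z}
  let act : E → Set ι := fun z => {i | a i z = b i}
  have key : ∀ z ∈ S, ∀ w ∈ S, act z = act w → quadFun T q z = quadFun T q w := by
    intro z hz w hw hzw
    have hmem : ∀ i, a i z = b i ↔ a i w = b i := fun i => Set.ext_iff.mp hzw i
    have h1 := hz.inner_eq_zero hw.1 fun i => (hmem i).1
    have h2 := hw.inner_eq_zero hz.1 fun i => (hmem i).2
    have h3 := quadFun_add hT q z (w - z)
    rw [add_sub_cancel] at h3
    have h4 := quadFun_add hT q w (z - w)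
    rw [add_sub_cancel] at h4
    have h5 : ⟪T (z - w), z - w⟫ = ⟪T (w - z), w - z⟫ := by
      rw [← neg_sub w z, map_neg, inner_neg_neg]
    rw [h1] at h3
    rw [h2, h5] at h4
    linarith
  let g : Set ι → ℝ := fun I =>
    if h : ∃ z, z ∈ S ∧ act z = I then quadFun T q h.choose else 0
  refine (Set.finite_range g).subset ?_
  rintro _ ⟨z, hz, rfl⟩
  have h : ∃ w, w ∈ S ∧ act w = act z := ⟨z, hz, rfl⟩
  refine ⟨act z, ?_⟩
  simp only [g, dif_pos h]
  exact key _ h.choose_spec.1 _ hz h.choose_spec.2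

lemma exists_pos_gap_of_finite {V : Set ℝ} (hV : V.Finite) (c : ℝ) :
    ∃ d > c, ∀ v ∈ V, v < d → v ≤ c := by
  have h : ∀ᶠ d in 𝓝[>] c, ∀ v ∈ V, v < d → v ≤ c := by
    rw [eventually_all_finite hV]
    intro v _
    rcases le_or_gt v c with hv | hv
    · exact Eventually.of_forall fun _ _ => hv
    · filter_upwards [Ioo_mem_nhdsGT hv] with d hd hvd
      exact absurd hvd hd.2.not_gt
  obtain ⟨d, hd, hc⟩ := (h.and self_mem_nhdsWithin).exists
  exact ⟨d, hc, hd⟩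

variable [FiniteDimensional ℝ E]

lemma exists_lower_bound_on_annulus {T : E →L[ℝ] E} {q : E} {C : Set E} (hC : IsClosed C)
    {z : E} {s r : ℝ} (hs : 0 < s)
    (hmin : ∀ w ∈ C, ‖w - z‖ ≤ r → w ≠ z → quadFun T q z < quadFun T q w) :
    ∃ d > quadFun T q z, ∀ w ∈ C, ‖w - z‖ ≤ r → quadFun T q w < d → ‖w - z‖ < s := by
  have := FiniteDimensional.proper ℝ E
  have hK : IsCompact (Metric.closedBall z r ∩ (C ∩ {w | s ≤ ‖w - z‖})) :=
    (isCompact_closedBall z r).inter_right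
      (hC.inter (isClosed_le continuous_const (by fun_prop)))
  rcases (Metric.closedBall z r ∩ (C ∩ {w | s ≤ ‖w - z‖})).eq_empty_or_nonempty with he | hne
  · refine ⟨quadFun T q z + 1, by linarith, fun w hw hr _ => ?_⟩
    by_contra! hsw
    exact Set.eq_empty_iff_forall_notMem.mp he w ⟨mem_closedBall_iff_norm.mpr hr, hw, hsw⟩
  · obtain ⟨y, ⟨hyr, hyC, hys⟩, hy⟩ :=
      hK.exists_isMinOn hne (quadFun_continuous T q).continuousOn
    refine ⟨quadFun T q y, hmin y hyC (mem_closedBall_iff_norm.mp hyr) ?_, ?_⟩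
    · rintro rfl
      simp at hys
      linarith
    · intro w hw hr hlt
      by_contra! hsw
      exact hlt.not_ge (hy ⟨mem_closedBall_iff_norm.mpr hr, hw, hsw⟩)

/-- A bounded proximal sequence with values below every larger critical value converges to a
strict local minimizer. -/
lemma tendsto_of_isProxPoint {T : E →L[ℝ] E} (hT : ∀ x y, ⟪T x, y⟫ = ⟪x, T y⟫) {q : E}
    {C : Set E} (hC : IsClosed C) (hconv : Convex ℝ C) {ρ : ℝ} (hρ : 0 < ρ) {z : E} {r d : ℝ}
    (hmin : ∀ w ∈ C, ‖w - z‖ ≤ r → w ≠ z → quadFun T q z < quadFun T q w)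
    (hcrit : ∀ w, IsStationaryOn T q C w → quadFun T q w < d → quadFun T q w ≤ quadFun T q z)
    {x : ℕ → E} (hx0 : quadFun T q (x 0) < d) (hxC : ∀ k, x k ∈ C)
    (hxr : ∀ k, ‖x k - z‖ ≤ r) (hprox : ∀ k, IsProxPoint T q C ρ (x k) (x (k+1))) :
    Tendsto x atTop (𝓝 z) := by
  have := FiniteDimensional.proper ℝ E
  have hanti : Antitone fun k => quadFun T q (x k) :=
    antitone_nat_of_succ_le fun k => (hprox k).quadFun_le hρ (hxC k)
  have hlow : ∀ k, quadFun T q z ≤ quadFun T q (x k) := by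
    intro k
    by_cases h : x k = z
    · rw [h]
    · exact (hmin _ (hxC k) (hxr k) h).le
  have hlim := tendsto_atTop_ciInf hanti ⟨quadFun T q z, Set.forall_mem_range.mpr hlow⟩
  refine tendsto_of_subseq_tendsto fun ns hns => ?_
  obtain ⟨y, hy, φ, hφ, hxy⟩ := ((isCompact_closedBall z r).inter_right hC).tendsto_subseq
    (x := fun k => x (ns k)) fun k => ⟨mem_closedBall_iff_norm.mpr (hxr _), hxC _⟩
  have hsub : Tendsto (fun k => ns (φ k)) atTop atTop := hns.comp hφ.tendsto_atTop
  have hfy : Tendsto (fun k => quadFun T q (x (ns (φ k)))) atTop (𝓝 (quadFun T q y)) :=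
    ((quadFun_continuous T q).tendsto y).comp hxy
  have heq := tendsto_nhds_unique hfy (hlim.comp hsub)
  have hyprox : IsProxPoint T q C ρ y y := by
    refine ⟨hy.2, fun w hw => ?_⟩
    have h1 : Tendsto (fun k => quadFun T q (x (ns (φ k) + 1))) atTop (𝓝 (quadFun T q y)) := by
      rw [heq]
      exact hlim.comp ((tendsto_add_atTop_nat 1).comp hsub)
    have hc : Continuous fun u => quadFun T q w + ρ / 2 * ‖w - u‖ ^ 2 := by fun_prop
    have h2 := (hc.tendsto y).comp hxy
    simp only [sub_self, norm_zero, ne_eq, OfNat.ofNat_ne_zero, not_false_eq_true, zero_pow,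
      mul_zero, add_zero]
    refine le_of_tendsto_of_tendsto' h1 h2 fun k => ?_
    have h3 := (hprox (ns (φ k))).2 w hw
    have h4 : 0 ≤ ρ / 2 * ‖x (ns (φ k) + 1) - x (ns (φ k))‖ ^ 2 := by positivity
    simp only [Function.comp_apply]
    linarith
  have hyd : quadFun T q y < d :=
    (le_of_tendsto' hfy fun k => hanti (Nat.zero_le _)).trans_lt hx0
  have hyz : y = z := by
    by_contra hne
    exact (hmin y hy.2 (mem_closedBall_iff_norm.mp hy.1) hne).not_ge
      (hcrit y (hyprox.isStationaryOn hT hconv) hyd)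
  exact ⟨φ, hyz ▸ hxy⟩

end ProximalQuadratic

/-- asymptotic stability of a locally unique solution w.r.t. Algorithm B,
assuming `ρ > ‖Q‖` (operator norm). -/
theorem stmt_1 {n m : ℕ} (Q : Matrix (Fin n) (Fin n) ℝ) (hQ : Q.IsHermitian)
    (q : EuclideanSpace ℝ (Fin n)) (A : Matrix (Fin m) (Fin n) ℝ) (b : Fin m → ℝ)
    (C : Set (EuclideanSpace ℝ (Fin n)))
    (hC : C = {x : EuclideanSpace ℝ (Fin n) | ∀ i, b i ≤ Matrix.toEuclideanLin A x i})
    (hCne : C.Nonempty)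
    (f : EuclideanSpace ℝ (Fin n) → ℝ)
    (hf : ∀ x, f x = (1/2) * ⟪Matrix.toEuclideanLin Q x, x⟫ + ⟪q, x⟫)
    (ρ : ℝ) (hρ : ‖Matrix.toEuclideanCLM (𝕜 := ℝ) Q‖ < ρ)
    (xstar : EuclideanSpace ℝ (Fin n)) (hxstarC : xstar ∈ C)
    -- `xstar` is a locally unique solution
    (ε₀ : ℝ) (hε₀ : 0 < ε₀)
    (hloc : ∀ x ∈ C ∩ Metric.ball xstar ε₀, x ≠ xstar → f xstar < f x) :
    ∀ ε > 0, ∃ δ > 0, ∀ x : ℕ → EuclideanSpace ℝ (Fin n),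
      x 0 ∈ C ∩ Metric.ball xstar δ →
      -- `x (k+1)` is the (unique) minimizer over `C` of `z ↦ f z + (ρ/2) ‖z - x k‖²`
      (∀ k, x (k+1) ∈ C ∧ ∀ z ∈ C,
        f (x (k+1)) + ρ/2 * ‖x (k+1) - x k‖^2 ≤ f z + ρ/2 * ‖z - x k‖^2) →
      (∀ k, x k ∈ C ∩ Metric.ball xstar ε) ∧ Tendsto x atTop (𝓝 xstar) := by
  intro ε hε
  set T := Matrix.toEuclideanCLM (𝕜 := ℝ) Q with hTdef
  have hT : ∀ x y, ⟪T x, y⟫ = ⟪x, T y⟫ :=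
    (Matrix.isSymmetric_toEuclideanLin_iff.mpr hQ :)
  obtain rfl : f = quadFun T q := funext hf
  let a : Fin m → EuclideanSpace ℝ (Fin n) →ₗ[ℝ] ℝ := fun i =>
    (EuclideanSpace.proj (𝕜 := ℝ) i).toLinearMap ∘ₗ Matrix.toEuclideanLin A
  have hCa : C = {x | ∀ i, b i ≤ a i x} := hC
  have hclosed : IsClosed C := by
    rw [hCa, Set.ofPred_forall]
    exact isClosed_iInter fun i =>
      isClosed_le continuous_const (a i).continuous_of_finiteDimensional
  have hconv : Convex ℝ C := by
    rw [hCa, Set.ofPred_forall]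
    exact convex_iInter fun i => convex_halfSpace_ge (a i).isLinear (b i)
  have hρ0 : 0 < ρ := (norm_nonneg T).trans_lt hρ
  have hgap : 0 < ρ - ‖T‖ := sub_pos.mpr hρ
  have hstat : IsStationaryOn T q C xstar := by
    refine isStationaryOn_of_local_min hT hconv hxstarC hε₀ fun w hw => ?_
    by_cases h : w = xstar
    · rw [h]
    · exact (hloc w hw h).le
  obtain ⟨d₁, hd₁, hcrit⟩ := exists_pos_gap_of_finite
    (finite_quadFun_image_isStationaryOn hT q a b) (quadFun T q xstar)
  rw [← hCa] at hcrit
  obtain ⟨r, hr, hrmin⟩ := exists_between (lt_min hε hε₀)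
  obtain ⟨hrε, hrε₀⟩ := lt_min_iff.mp hrmin
  have hmin : ∀ w ∈ C, ‖w - xstar‖ ≤ r → w ≠ xstar →
      quadFun T q xstar < quadFun T q w := fun w hw hwr =>
    hloc w ⟨hw, mem_ball_iff_norm.mpr (hwr.trans_lt hrε₀)⟩
  obtain ⟨s, hs, hsr⟩ : ∃ s > 0, ρ * s ≤ (ρ - ‖T‖) * r :=
    ⟨(ρ - ‖T‖) * r / ρ, by positivity, (mul_div_cancel₀ _ hρ0.ne').le⟩
  have hs_le : s ≤ r := by
    refine le_of_mul_le_mul_left (hsr.trans ?_) hρ0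
    nlinarith [norm_nonneg T]
  obtain ⟨d₂, hd₂, hann⟩ := exists_lower_bound_on_annulus hclosed hs hmin
  obtain ⟨δ, hδ, hball⟩ := Metric.eventually_nhds_iff_ball.mp
    (((quadFun_continuous T q).tendsto xstar).eventually (gt_mem_nhds (lt_min hd₁ hd₂)))
  refine ⟨min δ s, lt_min hδ hs, fun x hx0 hprox => ?_⟩
  obtain ⟨hx0C, hx0b⟩ := hx0
  have hx0s := mem_ball_iff_norm.mp hx0b
  obtain ⟨hfd₁, hfd₂⟩ := lt_min_iff.mp
    (hball (x 0) (Metric.ball_subset_ball (min_le_left _ _) hx0b))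
  have hxC : ∀ k, x k ∈ C := by
    rintro (_ | k)
    exacts [hx0C, (hprox k).1]
  have hstable : ∀ k, ‖x k - xstar‖ < s ∧ quadFun T q (x k) < d₂ := by
    intro k
    induction k with
    | zero => exact ⟨hx0s.trans_le (min_le_right _ _), hfd₂⟩
    | succ k ih =>
      have hp : IsProxPoint T q C ρ (x k) (x (k+1)) := hprox k
      have hlt := (hp.quadFun_le hρ0 (hxC k)).trans_lt ih.2
      refine ⟨hann _ hp.1 ?_ hlt, hlt⟩
      refine le_of_mul_le_mul_left ((hp.norm_sub_le hT hconv hρ hstat).trans ?_) hgap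
      exact (mul_le_mul_of_nonneg_left ih.1.le hρ0.le).trans hsr
  have hxr : ∀ k, ‖x k - xstar‖ ≤ r := fun k => (hstable k).1.le.trans hs_le
  refine ⟨fun k => ⟨hxC k, mem_ball_iff_norm.mpr ((hxr k).trans_lt hrε)⟩, ?_⟩
  exact tendsto_of_isProxPoint hT hclosed hconv hρ0 hmin
    (fun w hw => hcrit _ ⟨w, hw, rfl⟩) hfd₁ hxC hxr hprox
end

section
/- Let Q be a symmetric n×n real matrix, q ∈ ℝⁿ, and C = {x ∈ ℝⁿ : Ax ≥ b} nonempty. Suppose the KKT point set C* = {x ∈ C : ⟨Qx + q, u − x⟩ ≥ 0 for all u ∈ C} is nonempty. Then for any ρ > 0 there exist scalars ε > 0 and ℓ > 0 such that for every x ∈ C satisfying ‖x − P_C(x − (1/ρ)(Qx + q))‖ ≤ ε, one has dist(x, C*) ≤ ℓ ‖x − P_C(x − (1/ρ)(Qx + q))‖. -/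
open RealInnerProductSpace Filter Topology

/-- Finitely many lower and upper bounds that are compatible with each other and hold at `t` up to
an error `η` hold simultaneously at some point within `η` of `t`. -/
theorem exists_between_bounds_near {P K : Type*} [Finite P] (lo : P → ℝ) (up : K → ℝ)
    {t η : ℝ} (hη : 0 ≤ η) (hlu : ∀ i k, lo i ≤ up k) (hlo : ∀ i, lo i ≤ t + η)
    (hup : ∀ k, t - η ≤ up k) :
    ∃ s, (∀ i, lo i ≤ s) ∧ (∀ k, s ≤ up k) ∧ |s - t| ≤ η := by
  obtain ⟨o, ho⟩ := Finite.exists_max fun o : Option P => o.elim (t - η) lo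
  refine ⟨o.elim (t - η) lo, fun i => ho (some i), ?_, ?_⟩
  · cases o with
    | none => exact hup
    | some i => exact hlu i
  · have h0 : t - η ≤ o.elim (t - η) lo := ho none
    have h1 : o.elim (t - η) lo ≤ t + η := by
      cases o with
      | none => simp only [Option.elim_none]; linarith
      | some i => exact hlo i
    rw [abs_le]
    constructor <;> linarith

/-- **Hoffman's error bound** in coordinates, by Fourier–Motzkin elimination. The constant depends
only on the coefficients of the system of inequalities. -/
theorem hoffman_bound_pi (N : ℕ) : ∀ {ι : Type} [Finite ι] (M : ι → Fin N → ℝ),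
    ∃ L : ℝ, 0 ≤ L ∧ ∀ (d : ι → ℝ) (y : Fin N → ℝ) (δ : ℝ), 0 ≤ δ →
      (∃ y₀ : Fin N → ℝ, ∀ i, d i ≤ ∑ j, M i j * y₀ j) →
      (∀ i, d i ≤ ∑ j, M i j * y j + δ) →
      ∃ y' : Fin N → ℝ, (∀ i, d i ≤ ∑ j, M i j * y' j) ∧ ∀ j, |y' j - y j| ≤ L * δ := by
  induction N with
  | zero =>
    intro ι _ M
    refine ⟨0, le_rfl, fun d y δ _ ⟨y₀, h₀⟩ _ => ⟨y₀, h₀, fun j => j.elim0⟩⟩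
  | succ N ih =>
    intro ι _ M
    obtain ⟨κ, hκ⟩ := Set.Finite.bddAbove (Set.finite_range fun i => |M i 0|⁻¹)
    obtain ⟨S, hS⟩ := Set.Finite.bddAbove (Set.finite_range fun i => ∑ j : Fin N, |M i j.succ|)
    replace hκ : ∀ i, |M i 0|⁻¹ ≤ max κ 0 := fun i => (hκ ⟨i, rfl⟩).trans (le_max_left _ _)
    replace hS : ∀ i, ∑ j : Fin N, |M i j.succ| ≤ max S 0 :=
      fun i => (hS ⟨i, rfl⟩).trans (le_max_left _ _)
    generalize max κ 0 = κ, le_max_right κ 0 = hκ0 at hκ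
    generalize max S 0 = S, le_max_right S 0 = hS0 at hS
    let M' : {i // M i 0 = 0} ⊕ {i // 0 < M i 0} × {i // M i 0 < 0} → Fin N → ℝ :=
      Sum.elim (fun i j => M i j.succ)
        (fun p j => M p.1 j.succ / M p.1 0 - M p.2 j.succ / M p.2 0)
    obtain ⟨L, hL0, hL⟩ := ih M'
    have hrow : ∀ (p : {i // 0 < M i 0} × {i // M i 0 < 0}) (z : Fin N → ℝ),
        ∑ j, M' (Sum.inr p) j * z j =
          (∑ j, M p.1 j.succ * z j) / M p.1 0 - (∑ j, M p.2 j.succ * z j) / M p.2 0 := by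
      intro p z
      simp only [M', Sum.elim_inr, Finset.sum_div, ← Finset.sum_sub_distrib]
      exact Finset.sum_congr rfl fun j _ => by ring
    refine ⟨L * (1 + 2 * κ) + (κ + κ * (S * (L * (1 + 2 * κ)))), by positivity, ?_⟩
    rintro d y δ hδ ⟨y₀, h₀⟩ hy
    simp only [Fin.sum_univ_succ] at h₀ hy ⊢
    have hlow : ∀ (i : {i // 0 < M i 0}) (s w : ℝ),
        d i ≤ M i 0 * s + w ↔ d i / M i 0 - w / M i 0 ≤ s := by
      intro i s w
      rw [← sub_div, div_le_iff₀ i.2]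
      constructor <;> intro h <;> linarith
    have hupp : ∀ (i : {i // M i 0 < 0}) (s w : ℝ),
        d i ≤ M i 0 * s + w ↔ s ≤ d i / M i 0 - w / M i 0 := by
      intro i s w
      rw [← sub_div, le_div_iff_of_neg i.2]
      constructor <;> intro h <;> linarith
    have hκP : ∀ i : {i // 0 < M i 0}, δ / M i 0 ≤ κ * δ := by
      intro i
      have := hκ i
      rw [abs_of_pos i.2] at this
      rw [div_eq_inv_mul]
      gcongr
    have hκK : ∀ i : {i // M i 0 < 0}, -(κ * δ) ≤ δ / M i 0 := by
      intro i
      have := hκ i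
      rw [abs_of_neg i.2, inv_neg] at this
      rw [div_eq_inv_mul]
      nlinarith
    have hκδ : 0 ≤ κ * δ := by positivity
    have hdiff : ∀ (i : ι) (z z' : Fin N → ℝ) (r : ℝ), 0 ≤ r → (∀ j, |z' j - z j| ≤ r) →
        |(∑ j, M i j.succ * z' j) / M i 0 - (∑ j, M i j.succ * z j) / M i 0| ≤ κ * (S * r) := by
      intro i z z' r hr hz
      rw [← sub_div, ← Finset.sum_sub_distrib, abs_div, div_eq_inv_mul]
      refine mul_le_mul (hκ i) ?_ (abs_nonneg _) hκ0
      calc |∑ j, (M i j.succ * z' j - M i j.succ * z j)|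
          ≤ ∑ j, |M i j.succ * z' j - M i j.succ * z j| := Finset.abs_sum_le_sum_abs _ _
        _ ≤ ∑ j : Fin N, |M i j.succ| * r := by
            refine Finset.sum_le_sum fun j _ => ?_
            rw [← mul_sub, abs_mul]
            exact mul_le_mul_of_nonneg_left (hz j) (abs_nonneg _)
        _ ≤ S * r := by
            rw [← Finset.sum_mul]
            exact mul_le_mul_of_nonneg_right (hS i) hr
    obtain ⟨z', hz', hzz⟩ := hL
      (Sum.elim (fun i => d i) (fun p => d p.1 / M p.1 0 - d p.2 / M p.2 0))
      (fun j => y j.succ) ((1 + 2 * κ) * δ) (by positivity)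
      ⟨fun j => y₀ j.succ, by
        rintro (i | p)
        · have := h₀ i
          rw [i.2] at this
          simpa [M'] using this
        · have h1 := (hlow p.1 _ _).1 (h₀ p.1)
          have h2 := (hupp p.2 _ _).1 (h₀ p.2)
          rw [hrow, Sum.elim_inr]
          linarith⟩
      (by
        rintro (i | p)
        · have := hy i
          rw [i.2] at this
          simp only [M', Sum.elim_inl]
          linarith
        · have h1 := (hlow p.1 _ _).1 ((hy p.1).trans_eq (add_assoc _ _ _))
          have h2 := (hupp p.2 _ _).1 ((hy p.2).trans_eq (add_assoc _ _ _))
          rw [add_div] at h1 h2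
          have h3 := hκP p.1
          have h4 := hκK p.2
          rw [hrow, Sum.elim_inr]
          linarith)
    have hr0 : 0 ≤ L * ((1 + 2 * κ) * δ) := by positivity
    obtain ⟨s, hs1, hs2, hs3⟩ := exists_between_bounds_near
      (fun i : {i // 0 < M i 0} => d i / M i 0 - (∑ j, M i j.succ * z' j) / M i 0)
      (fun k : {i // M i 0 < 0} => d k / M k 0 - (∑ j, M k j.succ * z' j) / M k 0)
      (t := y 0) (η := κ * δ + κ * (S * (L * ((1 + 2 * κ) * δ)))) (by positivity)
      (fun i k => by
        have := hz' (Sum.inr (i, k))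
        rw [hrow, Sum.elim_inr] at this
        dsimp only at this
        linarith)
      (fun i => by
        have h1 := (hlow i _ _).1 ((hy i).trans_eq (add_assoc _ _ _))
        rw [add_div] at h1
        have h2 := abs_le.1 (hdiff i _ _ _ hr0 hzz)
        have h3 := hκP i
        linarith)
      (fun i => by
        have h1 := (hupp i _ _).1 ((hy i).trans_eq (add_assoc _ _ _))
        rw [add_div] at h1
        have h2 := abs_le.1 (hdiff i _ _ _ hr0 hzz)
        have h3 := hκK i
        linarith)
    refine ⟨Fin.cons s z', fun i => ?_, fun j => ?_⟩
    · simp only [Fin.cons_zero, Fin.cons_succ]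
      rcases lt_trichotomy (M i 0) 0 with h | h | h
      · exact (hupp ⟨i, h⟩ _ _).2 (hs2 ⟨i, h⟩)
      · have := hz' (Sum.inl ⟨i, h⟩)
        rw [h]
        simpa [M'] using this
      · exact (hlow ⟨i, h⟩ _ _).2 (hs1 ⟨i, h⟩)
    · refine Fin.cases ?_ (fun j => ?_) j
      · rw [Fin.cons_zero]
        linarith
      · rw [Fin.cons_succ]
        have := hzz j
        have h5 : 0 ≤ κ * (S * (L * ((1 + 2 * κ) * δ))) := by positivity
        linarith

/-- **Hoffman's error bound**: a point violating each inequality of a feasible finite linear system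
by at most `δ` is within `L * δ` of a solution, with `L` independent of the right-hand side. -/
theorem hoffman_bound {E : Type*} [NormedAddCommGroup E] [NormedSpace ℝ E] [FiniteDimensional ℝ E]
    {ι : Type} [Finite ι] (f : ι → E →ₗ[ℝ] ℝ) :
    ∃ L : ℝ, 0 ≤ L ∧ ∀ (d : ι → ℝ) (y : E) (δ : ℝ), 0 ≤ δ → (∃ y₀, ∀ i, d i ≤ f i y₀) →
      (∀ i, d i ≤ f i y + δ) → ∃ y', (∀ i, d i ≤ f i y') ∧ ‖y' - y‖ ≤ L * δ := by
  let B := Module.finBasis ℝ E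
  let e : E ≃L[ℝ] (Fin (Module.finrank ℝ E) → ℝ) := B.equivFunL
  have hf : ∀ i y, f i y = ∑ j, f i (B j) * e y j := by
    intro i y
    have h := congrArg (f i) (B.sum_equivFun y)
    rw [map_sum] at h
    rw [← h]
    exact Finset.sum_congr rfl fun j _ => by simp [e, mul_comm]
  obtain ⟨L, hL0, hL⟩ := hoffman_bound_pi _ fun i j => f i (B j)
  refine ⟨‖(e.symm : (Fin (Module.finrank ℝ E) → ℝ) →L[ℝ] E)‖ * L, by positivity, ?_⟩
  rintro d y δ hδ ⟨y₀, h₀⟩ hy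
  obtain ⟨y', hy', hyy⟩ := hL d (e y) δ hδ ⟨e y₀, fun i => by rw [← hf]; exact h₀ i⟩
    (fun i => by rw [← hf]; exact hy i)
  refine ⟨e.symm y', fun i => by rw [hf, e.apply_symm_apply]; exact hy' i, ?_⟩
  have h1 : e.symm y' - y = (e.symm : (Fin (Module.finrank ℝ E) → ℝ) →L[ℝ] E) (y' - e y) := by simp
  rw [h1, mul_assoc]
  refine (ContinuousLinearMap.le_opNorm _ _).trans ?_
  gcongr
  exact (pi_norm_le_iff_of_nonneg (by positivity)).2 hyy

/-- Solutions of a linear system whose right-hand side is perturbed by a small `r` are within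
`O(‖r‖)` of solutions of the unperturbed system; in particular such solutions exist as soon as the
system is solvable for some sufficiently small perturbation. -/
theorem exists_near_solution_of_small_perturbation {E F : Type*} [NormedAddCommGroup E]
    [NormedSpace ℝ E] [FiniteDimensional ℝ E] [NormedAddCommGroup F] [NormedSpace ℝ F]
    {ι : Type} [Finite ι] (f : ι → E →ₗ[ℝ] ℝ) (g : ι → F →L[ℝ] ℝ) (c : ι → ℝ) :
    ∃ ε > 0, ∃ l : ℝ, 0 < l ∧ ∀ y r, (∀ i, c i + g i r ≤ f i y) → ‖r‖ ≤ ε →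
      ∃ y', (∀ i, c i ≤ f i y') ∧ ‖y' - y‖ ≤ l * ‖r‖ := by
  obtain ⟨L, hL0, hL⟩ := hoffman_bound f
  obtain ⟨G, hG⟩ := Set.Finite.bddAbove (Set.finite_range fun i => ‖g i‖)
  replace hG : ∀ i, ‖g i‖ ≤ max G 0 := fun i => (hG ⟨i, rfl⟩).trans (le_max_left _ _)
  generalize max G 0 = G, le_max_right G 0 = hG0 at hG
  have hg : ∀ i r, |g i r| ≤ G * ‖r‖ := fun i r =>
    ((g i).le_opNorm r).trans (mul_le_mul_of_nonneg_right (hG i) (norm_nonneg r))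
  by_cases hne : ∃ y, ∀ i, c i ≤ f i y
  · refine ⟨1, one_pos, L * G + 1, by positivity, fun y r hy _ => ?_⟩
    obtain ⟨y', h1, h2⟩ := hL c y (G * ‖r‖) (by positivity) hne fun i => by
      have := (abs_le.1 (hg i r)).1
      have := hy i
      linarith
    refine ⟨y', h1, h2.trans ?_⟩
    nlinarith [norm_nonneg r]
  · suffices h : ∃ ε > 0, ∀ y r, (∀ i, c i + g i r ≤ f i y) → ¬ ‖r‖ ≤ ε by
      obtain ⟨ε, hε, h⟩ := h
      exact ⟨ε, hε, 1, one_pos, fun y r hy hr => (h y r hy hr).elim⟩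
    by_contra! hcon
    obtain ⟨D, hD⟩ := Set.Finite.bddAbove (Set.finite_range fun i => c i)
    replace hD : ∀ i, c i ≤ max D 0 := fun i => (hD ⟨i, rfl⟩).trans (le_max_left _ _)
    generalize max D 0 = D, le_max_right D 0 = hD0 at hD
    have hbdd : ∀ k : ℕ, ∃ y ∈ Metric.closedBall (0 : E) (L * (D + G)),
        ∀ i, c i - G * (1 / ((k : ℝ) + 1)) ≤ f i y := by
      intro k
      have hk : (0 : ℝ) < 1 / ((k : ℝ) + 1) := by positivity
      have hk1 : 1 / ((k : ℝ) + 1) ≤ 1 := by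
        rw [div_le_one (by positivity)]
        linarith [(Nat.cast_nonneg k : (0 : ℝ) ≤ k)]
      obtain ⟨y, r, hy, hr⟩ := hcon _ hk
      have hgr : ∀ i, |g i r| ≤ G * (1 / ((k : ℝ) + 1)) := fun i =>
        (hg i r).trans (mul_le_mul_of_nonneg_left hr hG0)
      obtain ⟨y', h1, h2⟩ := hL (fun i => c i + g i r) 0 (D + G) (by positivity) ⟨y, hy⟩
        fun i => by
          have h3 := (abs_le.1 (hgr i)).2
          have h4 := hD i
          rw [map_zero]
          nlinarith
      refine ⟨y', by simpa using h2, fun i => ?_⟩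
      have h3 := (abs_le.1 (hgr i)).1
      have h4 := h1 i
      linarith
    choose u hu1 hu2 using hbdd
    obtain ⟨a, -, φ, hφ, hlim⟩ := (isCompact_closedBall (0 : E) (L * (D + G))).tendsto_subseq hu1
    refine hne ⟨a, fun i => ?_⟩
    have hcont : Continuous (f i) := (f i).continuous_of_finiteDimensional
    have hl : Tendsto (fun k => c i - G * (1 / ((φ k : ℝ) + 1))) atTop (𝓝 (c i - G * 0)) :=
      tendsto_const_nhds.sub
        ((tendsto_one_div_add_atTop_nhds_zero_nat.comp hφ.tendsto_atTop).const_mul G)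
    rw [mul_zero, sub_zero] at hl
    exact le_of_tendsto_of_tendsto' hl ((hcont.tendsto a).comp hlim) fun k => hu2 (φ k) i

/-- The version of `exists_near_solution_of_small_perturbation` for systems that also contain
equations. -/
theorem exists_near_solution_of_small_perturbation_eq {E F : Type*} [NormedAddCommGroup E]
    [NormedSpace ℝ E] [FiniteDimensional ℝ E] [NormedAddCommGroup F] [NormedSpace ℝ F]
    {ι κ : Type} [Finite ι] [Fintype κ] (f : ι → E →ₗ[ℝ] ℝ) (g : ι → F →L[ℝ] ℝ) (c : ι → ℝ)
    (h : E →ₗ[ℝ] EuclideanSpace ℝ κ) (k : F →L[ℝ] EuclideanSpace ℝ κ) (e : EuclideanSpace ℝ κ) :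
    ∃ ε > 0, ∃ l : ℝ, 0 < l ∧ ∀ y r, (∀ i, c i + g i r ≤ f i y) → h y = e + k r → ‖r‖ ≤ ε →
      ∃ y', (∀ i, c i ≤ f i y') ∧ h y' = e ∧ ‖y' - y‖ ≤ l * ‖r‖ := by
  let π : κ → EuclideanSpace ℝ κ →L[ℝ] ℝ := fun j => EuclideanSpace.proj j
  obtain ⟨ε, hε, l, hl, H⟩ := exists_near_solution_of_small_perturbation
    (Sum.elim f (Sum.elim (fun j => (π j).toLinearMap ∘ₗ h) fun j => -((π j).toLinearMap ∘ₗ h)))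
    (Sum.elim g (Sum.elim (fun j => (π j).comp k) fun j => -((π j).comp k)))
    (Sum.elim c (Sum.elim (fun j => e j) fun j => -e j))
  refine ⟨ε, hε, l, hl, fun y r h1 h2 hr => ?_⟩
  obtain ⟨y', h3, h4⟩ := H y r (by
    rintro (i | j | j)
    · exact h1 i
    · simp [π, h2]
    · simp [π, h2, add_comm]) hr
  refine ⟨y', fun i => h3 (Sum.inl i), ?_, h4⟩
  ext j
  have h5 := h3 (Sum.inr (Sum.inl j))
  have h6 := h3 (Sum.inr (Sum.inr j))
  simp [π] at h5 h6
  exact le_antisymm h6 h5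

/-- **Farkas' lemma** for a finite family of vectors. -/
theorem exists_nonneg_sum_smul_eq_of_forall_inner_nonneg {ι κ : Type} [Fintype ι] [Fintype κ]
    (a : ι → EuclideanSpace ℝ κ) (v : EuclideanSpace ℝ κ)
    (hv : ∀ w, (∀ i, 0 ≤ ⟪a i, w⟫) → 0 ≤ ⟪v, w⟫) :
    ∃ μ : ι → ℝ, (∀ i, 0 ≤ μ i) ∧ ∑ i, μ i • a i = v := by
  let K : PointedCone ℝ (EuclideanSpace ℝ κ) := Submodule.span _ (Set.range a)
  let T : (ι → ℝ) →ₗ[ℝ] EuclideanSpace ℝ κ := Fintype.linearCombination ℝ a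
  have hvK : v ∈ closure (K : Set (EuclideanSpace ℝ κ)) := by
    by_contra hcon
    obtain ⟨w, hw, hvw⟩ := ProperCone.hyperplane_separation' (Submodule.closure K) hcon
    exact hvw.not_ge (hv w fun i =>
      hw _ (subset_closure (Submodule.subset_span (Set.mem_range_self i))))
  obtain ⟨ε, hε, _, _, H⟩ := exists_near_solution_of_small_perturbation_eq
    (fun i : ι => (LinearMap.proj i : (ι → ℝ) →ₗ[ℝ] ℝ))
    (fun _ => (0 : EuclideanSpace ℝ κ →L[ℝ] ℝ)) (fun _ => 0) T (ContinuousLinearMap.id ℝ _) v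
  obtain ⟨w, hwK, hw⟩ := Metric.mem_closure_iff.1 hvK ε hε
  obtain ⟨c, rfl⟩ := (Submodule.mem_span_range_iff_exists_fun _).1 hwK
  obtain ⟨μ, h1, h2, -⟩ := H (fun i => (c i : ℝ)) (∑ i, c i • a i - v)
    (fun i => by simpa using (c i).2) (by simp [T, Fintype.linearCombination_apply])
    (by rw [← dist_eq_norm, dist_comm]; exact hw.le)
  exact ⟨μ, h1, by simpa [T, Fintype.linearCombination_apply] using h2⟩

/-- Multipliers for a point at which a linear functional is minimal over a polyhedron. -/
theorem exists_multipliers {ι κ : Type} [Fintype ι] [Fintype κ] (a : ι → EuclideanSpace ℝ κ)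
    (b : ι → ℝ) {p v : EuclideanSpace ℝ κ} (hp : ∀ i, b i ≤ ⟪a i, p⟫)
    (hv : ∀ u, (∀ i, b i ≤ ⟪a i, u⟫) → 0 ≤ ⟪v, u - p⟫) :
    ∃ I : Finset ι, (∀ i ∈ I, ⟪a i, p⟫ = b i) ∧
      ∃ μ : ι → ℝ, (∀ i, 0 ≤ μ i) ∧ ∑ i ∈ I, μ i • a i = v := by
  classical
  refine ⟨Finset.univ.filter fun i => ⟪a i, p⟫ = b i, by simp, ?_⟩
  obtain ⟨μ, h1, h2⟩ := exists_nonneg_sum_smul_eq_of_forall_inner_nonneg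
    (fun i => if ⟪a i, p⟫ = b i then a i else 0) v (by
      intro w hw
      have hev : ∀ᶠ t : ℝ in 𝓝[>] 0, ∀ i, b i ≤ ⟪a i, p + t • w⟫ := by
        refine eventually_all.2 fun i => ?_
        rcases (hp i).eq_or_lt with h | h
        · have hwi := hw i
          rw [if_pos h.symm] at hwi
          filter_upwards [self_mem_nhdsWithin] with t ht
          rw [inner_add_right, inner_smul_right, ← h]
          have : 0 ≤ t * ⟪a i, w⟫ := mul_nonneg (le_of_lt ht) hwi
          linarith
        · have hc : Continuous fun t : ℝ => ⟪a i, p + t • w⟫ := by fun_prop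
          have h0 : b i < ⟪a i, p + (0 : ℝ) • w⟫ := by simpa using h
          exact ((hc.tendsto 0).eventually (lt_mem_nhds h0)).filter_mono nhdsWithin_le_nhds
            |>.mono fun t ht => ht.le
      obtain ⟨t, ht, ht0⟩ := (hev.and self_mem_nhdsWithin).exists
      have h := hv _ ht
      rw [add_sub_cancel_left, inner_smul_right] at h
      exact nonneg_of_mul_nonneg_right h ht0)
  refine ⟨μ, h1, ?_⟩
  rw [← h2, Finset.sum_filter]
  exact Finset.sum_congr rfl fun i _ => by split_ifs <;> simp

/-- The error bound for the part of the solution set of an affine variational inequality with a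
prescribed set `I` of active constraints. -/
theorem exists_near_kkt_of_active_set {ι κ : Type} [Fintype ι] [Fintype κ]
    (a : ι → EuclideanSpace ℝ κ) (b : ι → ℝ) (Q : EuclideanSpace ℝ κ →ₗ[ℝ] EuclideanSpace ℝ κ)
    (q : EuclideanSpace ℝ κ) (ρ : ℝ) (I : Finset ι) :
    ∃ ε > 0, ∃ l : ℝ, 0 < l ∧ ∀ x r (μ : ι → ℝ), (∀ i, b i ≤ ⟪a i, x + r⟫) →
      (∀ i ∈ I, ⟪a i, x + r⟫ = b i) → (∀ i, 0 ≤ μ i) →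
      ∑ i ∈ I, μ i • a i = Q x + q + ρ • r → ‖r‖ ≤ ε →
      ∃ x', (∀ i, b i ≤ ⟪a i, x'⟫) ∧ (∀ u, (∀ i, b i ≤ ⟪a i, u⟫) → 0 ≤ ⟪Q x' + q, u - x'⟫) ∧
        ‖x' - x‖ ≤ l * ‖r‖ := by
  let fs : EuclideanSpace ℝ κ × (ι → ℝ) →ₗ[ℝ] EuclideanSpace ℝ κ := LinearMap.fst ℝ _ _
  let α : ι → EuclideanSpace ℝ κ →L[ℝ] ℝ := fun i => innerSL ℝ (a i)
  let pr : ι → EuclideanSpace ℝ κ × (ι → ℝ) →ₗ[ℝ] ℝ :=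
    fun i => LinearMap.proj i ∘ₗ LinearMap.snd ℝ _ _
  obtain ⟨ε, hε, l, hl, H⟩ := exists_near_solution_of_small_perturbation_eq
    (Sum.elim (fun i => (α i).toLinearMap ∘ₗ fs)
      (Sum.elim (fun i : I => -((α i).toLinearMap ∘ₗ fs)) pr))
    (Sum.elim (fun i => -α i) (Sum.elim (fun i : I => α i) fun _ => 0))
    (Sum.elim b (Sum.elim (fun i : I => -b i) fun _ => 0))
    (∑ i ∈ I, (pr i).smulRight (a i) - Q ∘ₗ fs)
    (ρ • ContinuousLinearMap.id ℝ _) q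
  refine ⟨ε, hε, l, hl, fun x r μ h1 h2 h3 h4 hr => ?_⟩
  obtain ⟨⟨x', μ'⟩, h5, h6, h7⟩ := H (x, μ) r (by
    rintro (i | i | i)
    · have := h1 i
      rw [inner_add_right] at this
      simp [α, fs]
      linarith
    · have := h2 i i.2
      rw [inner_add_right] at this
      simp [α, fs]
      linarith
    · simpa [pr] using h3 i) (by simp [pr, fs, h4]; abel) hr
  have hx' : ∀ i, b i ≤ ⟪a i, x'⟫ := fun i => by simpa [α, fs] using h5 (Sum.inl i)
  have hxI : ∀ i ∈ I, ⟪a i, x'⟫ ≤ b i := fun i hi => by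
    simpa [α, fs] using h5 (Sum.inr (Sum.inl ⟨i, hi⟩))
  have hμ' : ∀ i, 0 ≤ μ' i := fun i => by simpa [pr] using h5 (Sum.inr (Sum.inr i))
  have hQ : Q x' + q = ∑ i ∈ I, μ' i • a i := by
    rw [← h6]
    simp [pr, fs]
  refine ⟨x', hx', fun u hu => ?_, (norm_fst_le ((x', μ') - (x, μ))).trans h7⟩
  rw [hQ, sum_inner]
  refine Finset.sum_nonneg fun i hi => ?_
  rw [real_inner_smul_left, inner_sub_right]
  exact mul_nonneg (hμ' i) (by linarith [hu i, hxI i hi])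

/-- Local error bound for an affine variational inequality over a polyhedron: if `x + r` solves the
inequality perturbed by a small `r`, then `x` is within `O(‖r‖)` of a solution. -/
theorem exists_near_kkt {ι κ : Type} [Fintype ι] [Fintype κ]
    (a : ι → EuclideanSpace ℝ κ) (b : ι → ℝ) (Q : EuclideanSpace ℝ κ →ₗ[ℝ] EuclideanSpace ℝ κ)
    (q : EuclideanSpace ℝ κ) (ρ : ℝ) :
    ∃ ε > 0, ∃ l : ℝ, 0 < l ∧ ∀ x r, (∀ i, b i ≤ ⟪a i, x + r⟫) →
      (∀ u, (∀ i, b i ≤ ⟪a i, u⟫) → 0 ≤ ⟪Q x + q + ρ • r, u - (x + r)⟫) → ‖r‖ ≤ ε →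
      ∃ x', (∀ i, b i ≤ ⟪a i, x'⟫) ∧ (∀ u, (∀ i, b i ≤ ⟪a i, u⟫) → 0 ≤ ⟪Q x' + q, u - x'⟫) ∧
        ‖x' - x‖ ≤ l * ‖r‖ := by
  choose ε hε l hl H using exists_near_kkt_of_active_set a b Q q ρ
  obtain ⟨I₀, hI₀⟩ := Finite.exists_min ε
  obtain ⟨I₁, hI₁⟩ := Finite.exists_max l
  refine ⟨ε I₀, hε I₀, l I₁, hl I₁, fun x r h1 h2 hr => ?_⟩
  obtain ⟨I, hI, μ, hμ, hsum⟩ := exists_multipliers a b h1 h2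
  obtain ⟨x', h3, h4, h5⟩ := H I x r μ h1 hI hμ hsum (hr.trans (hI₀ I))
  exact ⟨x', h3, h4, h5.trans (mul_le_mul_of_nonneg_right (hI₁ I) (norm_nonneg r))⟩

/-- local error bound for the distance from a feasible point to the KKT point
set of the IQP, in terms of the natural residual. -/
theorem stmt_2 {n m : ℕ} (Q : Matrix (Fin n) (Fin n) ℝ) (hQ : Q.IsHermitian)
    (q : EuclideanSpace ℝ (Fin n)) (A : Matrix (Fin m) (Fin n) ℝ) (b : Fin m → ℝ)
    (C : Set (EuclideanSpace ℝ (Fin n)))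
    (hC : C = {x : EuclideanSpace ℝ (Fin n) | ∀ i, b i ≤ Matrix.toEuclideanLin A x i})
    (hCne : C.Nonempty)
    (Cstar : Set (EuclideanSpace ℝ (Fin n)))
    (hCstar : Cstar = {x ∈ C | ∀ u ∈ C, 0 ≤ ⟪Matrix.toEuclideanLin Q x + q, u - x⟫})
    (hCstarNe : Cstar.Nonempty)
    (ρ : ℝ) (hρ : 0 < ρ) :
    ∃ ε > 0, ∃ ℓ > 0, ∀ x ∈ C, ∀ p ∈ C,
      -- `p = P_C (x - (1/ρ)(Qx + q))`
      (∀ z ∈ C, ‖(x - (1/ρ) • (Matrix.toEuclideanLin Q x + q)) - p‖ ≤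
        ‖(x - (1/ρ) • (Matrix.toEuclideanLin Q x + q)) - z‖) →
      ‖x - p‖ ≤ ε → Metric.infDist x Cstar ≤ ℓ * ‖x - p‖ := by
  obtain ⟨ε, hε, l, hl, H⟩ := exists_near_kkt (fun i => WithLp.toLp 2 (A i)) b
    (Matrix.toEuclideanLin Q) q ρ
  have hmem : ∀ x, x ∈ C ↔ ∀ i, b i ≤ ⟪WithLp.toLp 2 (A i), x⟫ := by
    intro x
    rw [hC]
    refine forall_congr' fun i => ?_
    rw [Matrix.toLpLin_apply, EuclideanSpace.inner_eq_star_dotProduct]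
    simp [Matrix.mulVec, dotProduct_comm]
  have hconv : Convex ℝ C := by
    intro x hx y hy s t hs ht hst
    rw [hmem] at hx hy ⊢
    intro i
    rw [inner_add_right, inner_smul_right, inner_smul_right]
    calc b i = s * b i + t * b i := by rw [← add_mul, hst, one_mul]
      _ ≤ _ := add_le_add (mul_le_mul_of_nonneg_left (hx i) hs)
        (mul_le_mul_of_nonneg_left (hy i) ht)
  refine ⟨ε, hε, l, hl, fun x _ p hp hproj hxp => ?_⟩
  rw [norm_sub_rev] at hxp ⊢
  have : Nonempty C := hCne.to_subtype
  have hvar := (norm_eq_iInf_iff_real_inner_le_zero hconv hp).1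
    (le_antisymm (le_ciInf fun z : C => hproj z z.2)
      (ciInf_le ⟨0, by rintro _ ⟨z, rfl⟩; positivity⟩ (⟨p, hp⟩ : C)))
  obtain ⟨x', h1, h2, h3⟩ := H x (p - x) (by rwa [add_sub_cancel, ← hmem]) (by
    intro u hu
    have h := hvar u ((hmem u).2 hu)
    have he : Matrix.toEuclideanLin Q x + q + ρ • (p - x) =
        (-ρ) • (x - (1 / ρ) • (Matrix.toEuclideanLin Q x + q) - p) := by
      match_scalars <;> field_simp
    rw [add_sub_cancel, he, real_inner_smul_left]
    nlinarith) hxp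
  have hx' : x' ∈ Cstar := by
    rw [hCstar]
    exact ⟨(hmem x').2 h1, fun u hu => h2 u ((hmem u).1 hu)⟩
  refine (Metric.infDist_le_dist_of_mem hx').trans ?_
  rwa [dist_comm, dist_eq_norm]
end

section
/- Let Q be a symmetric n×n real matrix, q ∈ ℝⁿ, and C = {x ∈ ℝⁿ : Ax ≥ b}. The KKT point set C* = {x ∈ C : ⟨Qx + q, u − x⟩ ≥ 0 for all u ∈ C} is the union of finitely many polyhedral convex sets (hence it has finitely many connected components). -/
open RealInnerProductSpace Filter Topology

/-- A polyhedral convex set: the solution set of a finite system of linear inequalities. -/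
def IsPolyhedral {n : ℕ} (S : Set (EuclideanSpace ℝ (Fin n))) : Prop :=
  ∃ (m : ℕ) (A : Matrix (Fin m) (Fin n) ℝ) (b : Fin m → ℝ),
    S = {x : EuclideanSpace ℝ (Fin n) | ∀ i, b i ≤ Matrix.toEuclideanLin A x i}

/-- Intersecting a finitely generated cone with a closed half-space yields a finitely generated
cone (one step of the double description method). -/
theorem PointedCone.fg_inf_comap_positive {E : Type*} [AddCommGroup E] [Module ℝ E]
    {K : PointedCone ℝ E} (hK : K.FG) (a : E →ₗ[ℝ] ℝ) :
    (K ⊓ (PointedCone.positive ℝ ℝ).comap a).FG := by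
  obtain ⟨V, hV, rfl⟩ := Submodule.fg_def.1 hK
  set P : Set E := {v ∈ V | 0 ≤ a v} with hP
  set N : Set E := {v ∈ V | a v < 0} with hN
  set W : Set E := P ∪ (fun p : E × E => a p.1 • p.2 - a p.2 • p.1) '' (P ×ˢ N) with hW
  have hPfin : P.Finite := hV.subset (Set.sep_subset _ _)
  have hNfin : N.Finite := hV.subset (Set.sep_subset _ _)
  refine Submodule.fg_def.2 ⟨W, hPfin.union ((hPfin.prod hNfin).image _), le_antisymm ?_ ?_⟩
  · refine Submodule.span_le.2 ?_
    rintro x (hx | ⟨⟨v, w⟩, ⟨hv, hw⟩, rfl⟩)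
    · exact ⟨Submodule.subset_span hx.1, by simpa using hx.2⟩
    · have hv0 : 0 ≤ a v := hv.2
      have hw0 : a w < 0 := hw.2
      refine ⟨?_, ?_⟩
      · have h1 := PointedCone.smul_mem (PointedCone.hull ℝ V) hv0 (Submodule.subset_span hw.1)
        have h2 := PointedCone.smul_mem (PointedCone.hull ℝ V) (neg_nonneg.2 hw0.le)
          (Submodule.subset_span hv.1)
        have h3 := add_mem h1 h2
        rwa [neg_smul, ← sub_eq_add_neg] at h3
      · simp [mul_comm (a v)]
  · have mix : ∀ y ∈ PointedCone.hull ℝ P, ∀ z ∈ PointedCone.hull ℝ N,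
        a y • z - a z • y ∈ PointedCone.hull ℝ W := by
      intro y hy z hz
      induction hy using Submodule.span_induction with
      | zero => simp
      | add y y' _ _ h h' =>
        convert add_mem h h' using 1
        simp only [map_add]
        module
      | smul c y _ h =>
        convert PointedCone.smul_mem _ c.2 h using 1
        change a ((c : ℝ) • y) • z - a z • ((c : ℝ) • y) = (c : ℝ) • _
        simp only [map_smul, smul_eq_mul]
        module
      | mem y hy =>
        induction hz using Submodule.span_induction with
        | zero => simp
        | add z z' _ _ h h' =>
          convert add_mem h h' using 1
          simp only [map_add]
          module
        | smul c z _ h =>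
          convert PointedCone.smul_mem _ c.2 h using 1
          change a y • ((c : ℝ) • z) - a ((c : ℝ) • z) • y = (c : ℝ) • _
          simp only [map_smul, smul_eq_mul]
          module
        | mem z hz => exact Submodule.subset_span (Or.inr ⟨(y, z), ⟨hy, hz⟩, rfl⟩)
    have neg : ∀ z ∈ PointedCone.hull ℝ N, z = 0 ∨ a z < 0 := by
      intro z hz
      induction hz using Submodule.span_induction with
      | zero => exact Or.inl rfl
      | add z z' _ _ h h' =>
        rcases h with rfl | h
        · simpa using h'
        · rcases h' with rfl | h'
          · simpa using Or.inr h
          · exact Or.inr (by rw [map_add]; linarith)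
      | smul c z _ h =>
        rcases h with rfl | h
        · simp
        · rcases c.2.eq_or_lt with hc | hc
          · left
            change (c : ℝ) • z = 0
            rw [← hc, zero_smul]
          · right
            change a ((c : ℝ) • z) < 0
            rw [map_smul, smul_eq_mul]
            exact mul_neg_of_pos_of_neg hc h
      | mem z hz => exact Or.inr hz.2
    rintro x ⟨hxV, hx⟩
    replace hx : 0 ≤ a x := by simpa using hx
    have hVPN : V = P ∪ N := by
      ext v
      simp only [hP, hN, Set.mem_union, Set.mem_ofPred_eq, ← and_or_left]
      exact ⟨fun h => ⟨h, le_or_gt 0 (a v)⟩, fun h => h.1⟩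
    rw [hVPN, Submodule.span_union, SetLike.mem_coe] at hxV
    obtain ⟨y, hy, z, hz, rfl⟩ := Submodule.mem_sup.1 hxV
    have hyW : y ∈ PointedCone.hull ℝ W := Submodule.span_mono Set.subset_union_left hy
    rcases neg z hz with rfl | hz0
    · simpa using hyW
    · rw [map_add] at hx
      have hy0 : 0 < a y := by linarith
      have h1 := PointedCone.smul_mem _ (inv_nonneg.2 hy0.le) (mix y hy z hz)
      have h2 := PointedCone.smul_mem _ (div_nonneg hx hy0.le) hyW
      convert add_mem h1 h2 using 1
      rw [smul_sub, smul_smul, smul_smul, inv_mul_cancel₀ hy0.ne', add_div, div_self hy0.ne']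
      module

/-- The Minkowski–Weyl theorem: a polyhedral cone in a finite-dimensional space is finitely
generated. -/
theorem PointedCone.fg_finset_inf_comap_positive {E ι : Type*} [AddCommGroup E] [Module ℝ E]
    [Module.Finite ℝ E] (a : ι → E →ₗ[ℝ] ℝ) (s : Finset ι) :
    (s.inf fun i => (PointedCone.positive ℝ ℝ).comap (a i)).FG := by
  classical
  induction s using Finset.induction_on with
  | empty => exact Module.Finite.fg_top
  | insert i s _ ih =>
    rw [Finset.inf_insert, inf_comm]
    exact PointedCone.fg_inf_comap_positive ih (a i)

/-- The dual of a polyhedral cone is cut out by finitely many vectors of the cone. -/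
theorem exists_finite_generators_of_polyhedral_cone {E ι : Type*} [AddCommGroup E] [Module ℝ E]
    [Module.Finite ℝ E] (a : ι → E →ₗ[ℝ] ℝ) (s : Finset ι) :
    ∃ V : Finset E, (∀ v ∈ V, ∀ i ∈ s, 0 ≤ a i v) ∧
      ∀ f : E →ₗ[ℝ] ℝ, (∀ v ∈ V, 0 ≤ f v) → ∀ x, (∀ i ∈ s, 0 ≤ a i x) → 0 ≤ f x := by
  obtain ⟨V, hV⟩ := PointedCone.fg_finset_inf_comap_positive a s
  have hmem : ∀ x, x ∈ PointedCone.hull ℝ (V : Set E) ↔ ∀ i ∈ s, 0 ≤ a i x := by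
    intro x
    change x ∈ Submodule.span _ _ ↔ _
    rw [hV, Submodule.mem_finsetInf]
    simp
  refine ⟨V, fun v hv => (hmem v).1 (Submodule.subset_span hv), fun f hf x hx => ?_⟩
  have hle : PointedCone.hull ℝ (V : Set E) ≤ (PointedCone.positive ℝ ℝ).comap f :=
    Submodule.span_le.2 fun v hv => by simpa using hf v hv
  simpa using hle ((hmem x).2 hx)

theorem isPolyhedral_setOf_forall_le {n : ℕ} {ι : Type*} [Finite ι]
    (f : ι → EuclideanSpace ℝ (Fin n) →ₗ[ℝ] ℝ) (c : ι → ℝ) :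
    IsPolyhedral {x | ∀ i, c i ≤ f i x} := by
  obtain ⟨k, ⟨e⟩⟩ := Finite.exists_equiv_fin ι
  let F : EuclideanSpace ℝ (Fin n) →ₗ[ℝ] EuclideanSpace ℝ (Fin k) :=
    (WithLp.linearEquiv 2 ℝ (Fin k → ℝ)).symm.toLinearMap ∘ₗ LinearMap.pi fun j => f (e.symm j)
  refine ⟨k, Matrix.toEuclideanLin.symm F, fun j => c (e.symm j), ?_⟩
  ext x
  rw [LinearEquiv.apply_symm_apply]
  exact ⟨fun h j => h (e.symm j), fun h i => by simpa [F] using h (e i)⟩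

theorem IsPolyhedral.convex {n : ℕ} {S : Set (EuclideanSpace ℝ (Fin n))} (hS : IsPolyhedral S) :
    Convex ℝ S := by
  obtain ⟨m, A, b, rfl⟩ := hS
  rw [Set.ofPred_forall]
  exact convex_iInter fun i => convex_halfSpace_ge
    ((EuclideanSpace.proj i).toLinearMap ∘ₗ Matrix.toEuclideanLin A).isLinear (b i)

/-- A finite union of preconnected sets has finitely many connected components. -/
theorem finite_connectedComponentIn_iUnion {X ι : Type*} [TopologicalSpace X] [Finite ι]
    {S : ι → Set X} (hS : ∀ i, IsPreconnected (S i)) :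
    {T : Set X | ∃ x ∈ ⋃ i, S i, T = connectedComponentIn (⋃ i, S i) x}.Finite := by
  classical
  refine (Set.finite_range fun i : ι =>
    if h : (S i).Nonempty then connectedComponentIn (⋃ i, S i) h.some else ∅).subset ?_
  rintro T ⟨x, hx, rfl⟩
  obtain ⟨i, hi⟩ := Set.mem_iUnion.1 hx
  have h : (S i).Nonempty := ⟨x, hi⟩
  refine ⟨i, ?_⟩
  simp only [h, dif_pos]
  exact connectedComponentIn_eq
    ((hS i).subset_connectedComponentIn h.some_mem (Set.subset_iUnion S i) hi)

/-- From a point satisfying finitely many affine inequalities, a direction that does not decrease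
the active ones is feasible for a small positive step. -/
theorem exists_pos_forall_le_add_smul {E ι : Type*} [AddCommGroup E] [Module ℝ E] [Finite ι]
    (a : ι → E →ₗ[ℝ] ℝ) (b : ι → ℝ) {x v : E} (hx : ∀ i, b i ≤ a i x)
    (hv : ∀ i, a i x = b i → 0 ≤ a i v) : ∃ t : ℝ, 0 < t ∧ ∀ i, b i ≤ a i (x + t • v) := by
  have key : ∀ i, ∀ᶠ t : ℝ in 𝓝[>] 0, b i ≤ a i (x + t • v) := by
    intro i
    simp only [map_add, map_smul, smul_eq_mul]
    rcases (hx i).eq_or_lt with h | h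
    · filter_upwards [self_mem_nhdsWithin] with t ht
      have := mul_nonneg (le_of_lt ht) (hv i h.symm)
      linarith
    · have hc : Tendsto (fun t : ℝ => a i x + t * a i v) (𝓝[>] 0) (𝓝 (a i x)) := by
        have : Continuous fun t : ℝ => a i x + t * a i v := by fun_prop
        simpa using (this.tendsto 0).mono_left nhdsWithin_le_nhds
      exact (hc.eventually_const_lt h).mono fun t ht => ht.le
  obtain ⟨t, ht, ht0⟩ := ((eventually_all.2 key).and self_mem_nhdsWithin).exists
  exact ⟨t, ht0, ht⟩

/-- the KKT point set of the IQP is a finite union of polyhedral convex sets;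
hence it has finitely many connected components. -/
theorem stmt_3 {n m : ℕ} (Q : Matrix (Fin n) (Fin n) ℝ) (hQ : Q.IsHermitian)
    (q : EuclideanSpace ℝ (Fin n)) (A : Matrix (Fin m) (Fin n) ℝ) (b : Fin m → ℝ)
    (C : Set (EuclideanSpace ℝ (Fin n)))
    (hC : C = {x : EuclideanSpace ℝ (Fin n) | ∀ i, b i ≤ Matrix.toEuclideanLin A x i})
    (Cstar : Set (EuclideanSpace ℝ (Fin n)))
    (hCstar : Cstar = {x ∈ C | ∀ u ∈ C, 0 ≤ ⟪Matrix.toEuclideanLin Q x + q, u - x⟫}) :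
    (∃ (r : ℕ) (S : Fin r → Set (EuclideanSpace ℝ (Fin n))),
      (∀ i, IsPolyhedral (S i)) ∧ Cstar = ⋃ i, S i) ∧
    {T : Set (EuclideanSpace ℝ (Fin n)) | ∃ x ∈ Cstar, T = connectedComponentIn Cstar x}.Finite := by
  classical
  let a : Fin m → EuclideanSpace ℝ (Fin n) →ₗ[ℝ] ℝ := fun i =>
    (EuclideanSpace.proj i).toLinearMap ∘ₗ Matrix.toEuclideanLin A
  have hCmem : ∀ x, x ∈ C ↔ ∀ i, b i ≤ a i x := fun x => by rw [hC]; rfl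
  choose V hV hVdual using fun I : Finset (Fin m) =>
    exists_finite_generators_of_polyhedral_cone a I
  let f (I : Finset (Fin m)) : Fin m ⊕ I ⊕ V I → EuclideanSpace ℝ (Fin n) →ₗ[ℝ] ℝ :=
    Sum.elim a (Sum.elim (fun i => -a i) fun v => innerₗ _ v.1 ∘ₗ Matrix.toEuclideanLin Q)
  let c (I : Finset (Fin m)) : Fin m ⊕ I ⊕ V I → ℝ :=
    Sum.elim b (Sum.elim (fun i => -b i) fun v => -⟪q, v.1⟫)
  let S (I : Finset (Fin m)) : Set (EuclideanSpace ℝ (Fin n)) := {x | ∀ j, c I j ≤ f I j x}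
  have hSmem : ∀ I x, x ∈ S I ↔ (∀ i, b i ≤ a i x) ∧ (∀ i ∈ I, a i x ≤ b i) ∧
      ∀ v ∈ V I, 0 ≤ ⟪Matrix.toEuclideanLin Q x + q, v⟫ := by
    intro I x
    simp only [S, c, f, Set.mem_ofPred_eq, Sum.forall, Sum.elim_inl, Sum.elim_inr, Subtype.forall,
      LinearMap.neg_apply, LinearMap.comp_apply, innerₗ_apply_apply,
      inner_add_left, neg_le_iff_add_nonneg, real_inner_comm, neg_add_eq_sub, sub_nonneg]
  have hpoly : ∀ I, IsPolyhedral (S I) := fun I => isPolyhedral_setOf_forall_le (f I) (c I)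
  have hunion : Cstar = ⋃ I, S I := by
    ext x
    simp only [hCstar, Set.mem_iUnion, hSmem, Set.mem_ofPred_eq, hCmem]
    constructor
    · rintro ⟨hx, hkkt⟩
      refine ⟨Finset.univ.filter fun i => a i x = b i, hx, fun i hi => ?_, fun v hv => ?_⟩
      · exact (Finset.mem_filter.1 hi).2.le
      · obtain ⟨t, ht, hxt⟩ := exists_pos_forall_le_add_smul a b (v := v) hx fun i hi =>
          hV _ v hv i (Finset.mem_filter.2 ⟨Finset.mem_univ i, hi⟩)
        have := hkkt _ hxt
        rw [add_sub_cancel_left, real_inner_smul_right] at this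
        exact nonneg_of_mul_nonneg_right this ht
    · rintro ⟨I, hx, hxI, hxV⟩
      refine ⟨hx, fun u hu => hVdual I (innerₗ _ (Matrix.toEuclideanLin Q x + q)) hxV (u - x)
        fun i hi => ?_⟩
      rw [map_sub, sub_nonneg]
      exact (hxI i hi).trans (hu i)
  refine ⟨?_, ?_⟩
  · let e := Fintype.equivFin (Finset (Fin m))
    exact ⟨_, S ∘ e.symm, fun i => hpoly _, by rw [hunion]; exact (e.symm.iSup_comp (g := S)).symm⟩
  · rw [hunion]
    exact finite_connectedComponentIn_iUnion fun I => (hpoly I).convex.isPreconnected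
end

section
/- Let Q be a symmetric n×n real matrix, q ∈ ℝⁿ, C = {x ∈ ℝⁿ : Ax ≥ b}, and let C* be the KKT point set of min{½xᵀQx + qᵀx : x ∈ C}. If C₁, …, C_r are the connected components of C*, then they are properly separated from one another: there exists δ > 0 such that whenever i ≠ j, dist(x, C_j) ≥ δ for every x ∈ C_i. -/
open RealInnerProductSpace Filter Topology

/-- Homogeneous **Farkas lemma** for finitely many linear functionals on a real vector space. -/
theorem exists_nonneg_combination_of_forall_nonneg {V ι : Type*} [AddCommGroup V] [Module ℝ V]
    (s : Finset ι) (a : ι → V →ₗ[ℝ] ℝ) (c : V →ₗ[ℝ] ℝ)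
    (h : ∀ v, (∀ i ∈ s, 0 ≤ a i v) → 0 ≤ c v) :
    ∃ l : ι → ℝ, (∀ i, 0 ≤ l i) ∧ ∀ v, c v = ∑ i ∈ s, l i * a i v := by
  classical
  induction s using Finset.induction_on generalizing a c with
  | empty =>
    refine ⟨0, fun _ => le_rfl, fun v => ?_⟩
    have h₁ := h v (by simp)
    have h₂ := h (-v) (by simp)
    rw [map_neg] at h₂
    simp only [Finset.sum_empty]
    linarith
  | insert k s hk ih =>
    by_cases hs : ∀ v, (∀ i ∈ s, 0 ≤ a i v) → 0 ≤ c v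
    · obtain ⟨l, hl, hc⟩ := ih a c hs
      refine ⟨Function.update l k 0, fun i => ?_, fun v => ?_⟩
      · rcases eq_or_ne i k with rfl | hik <;> simp [*]
      · rw [Finset.sum_insert hk, hc v]
        simp only [Function.update_self, zero_mul, zero_add]
        refine Finset.sum_congr rfl fun i hi => ?_
        rw [Function.update_of_ne (ne_of_mem_of_not_mem hi hk)]
    · push Not at hs
      obtain ⟨x, hx, hcx⟩ := hs
      have hkx : a k x < 0 := by
        by_contra! hkx
        exact hcx.not_ge (h x (by simpa [hkx] using hx))
      set y : V := (-(a k x)⁻¹) • x with hy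
      have hr : 0 < -(a k x)⁻¹ := by simpa using hkx
      have hky : a k y = -1 := by
        rw [hy, map_smul, smul_eq_mul, neg_mul, inv_mul_cancel₀ hkx.ne]
      have hsy : ∀ i ∈ s, 0 ≤ a i y := fun i hi => by
        rw [hy, map_smul]
        exact mul_nonneg hr.le (hx i hi)
      have hcy : c y ≤ 0 := by
        rw [hy, map_smul]
        exact mul_nonpos_of_nonneg_of_nonpos hr.le hcx.le
      obtain ⟨l, hl, hc⟩ := ih (fun i => a i + a i y • a k) (c + c y • a k) (by
        intro v hv
        have := h (v + a k v • y) (by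
          intro i hi
          rcases Finset.mem_insert.1 hi with rfl | hi
          · simp [hky]
          · simpa [mul_comm] using hv i hi)
        simpa [mul_comm] using this)
      refine ⟨Function.update l k (∑ i ∈ s, l i * a i y - c y), fun i => ?_, fun v => ?_⟩
      · rcases eq_or_ne i k with rfl | hik
        · rw [Function.update_self]
          have := Finset.sum_nonneg fun i hi => mul_nonneg (hl i) (hsy i hi)
          linarith
        · rw [Function.update_of_ne hik]
          exact hl i
      · have hv := hc v
        simp only [LinearMap.add_apply, LinearMap.smul_apply, smul_eq_mul, mul_add,
          Finset.sum_add_distrib, ← mul_assoc, ← Finset.sum_mul] at hv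
        have hupd : ∑ i ∈ s, Function.update l k (∑ i ∈ s, l i * a i y - c y) i * a i v =
            ∑ i ∈ s, l i * a i v := Finset.sum_congr rfl fun i hi => by
          rw [Function.update_of_ne (ne_of_mem_of_not_mem hi hk)]
        rw [Finset.sum_insert hk, Function.update_self, hupd]
        linarith

/-- An infeasible finite system of affine inequalities stays infeasible when all its right-hand
sides are relaxed by a small amount. -/
theorem exists_pos_forall_exists_lt_sub {V ι : Type*} [AddCommGroup V] [Module ℝ V]
    (s : Finset ι) (a : ι → V →ₗ[ℝ] ℝ) (h : ι → ℝ) (hs : ∀ z, ∃ i ∈ s, a i z < h i) :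
    ∃ ε > 0, ∀ z, ∃ i ∈ s, a i z < h i - ε := by
  obtain ⟨l, hl, hc⟩ := exists_nonneg_combination_of_forall_nonneg s
    (fun i => a i ∘ₗ LinearMap.fst ℝ V ℝ - h i • LinearMap.snd ℝ V ℝ)
    (-LinearMap.snd ℝ V ℝ) (by
      rintro ⟨z, t⟩ hz
      by_contra! ht
      replace ht : 0 < t := by simpa using ht
      obtain ⟨i, hi, hlt⟩ := hs (t⁻¹ • z)
      have hiz : 0 ≤ a i z - h i * t := by simpa using hz i hi
      rw [map_smul, smul_eq_mul, inv_mul_lt_iff₀ ht] at hlt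
      linarith)
  have hsum : 0 ≤ ∑ i ∈ s, l i := Finset.sum_nonneg fun i _ => hl i
  refine ⟨(1 + ∑ i ∈ s, l i)⁻¹, by positivity, fun z => ?_⟩
  by_contra! hz
  have hcz : -1 = ∑ i ∈ s, l i * (a i z - h i) := by simpa using hc (z, 1)
  have hle : ∑ i ∈ s, l i * -(1 + ∑ i ∈ s, l i)⁻¹ ≤ ∑ i ∈ s, l i * (a i z - h i) :=
    Finset.sum_le_sum fun i hi => mul_le_mul_of_nonneg_left (by linarith [hz i hi]) (hl i)
  rw [← hcz, ← Finset.sum_mul, mul_neg, neg_le_neg_iff, ← div_eq_mul_inv,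
    le_div_iff₀ (by positivity)] at hle
  linarith

/-- A polyhedron is the solution set of finitely many affine inequalities. -/
def IsPolyhedron {V : Type*} [AddCommGroup V] [Module ℝ V] (S : Set V) : Prop :=
  ∃ F : Finset ((V →ₗ[ℝ] ℝ) × ℝ), S = {z | ∀ f ∈ F, f.2 ≤ f.1 z}

namespace IsPolyhedron

variable {V W : Type*} [AddCommGroup V] [Module ℝ V] [AddCommGroup W] [Module ℝ W]

theorem setOf_le (f : V →ₗ[ℝ] ℝ) (r : ℝ) : IsPolyhedron {z | r ≤ f z} :=
  ⟨{(f, r)}, by simp⟩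

theorem setOf_ge (f : V →ₗ[ℝ] ℝ) (r : ℝ) : IsPolyhedron {z | f z ≤ r} := by
  simpa using setOf_le (-f) (-r)

theorem inter {S T : Set V} (hS : IsPolyhedron S) (hT : IsPolyhedron T) :
    IsPolyhedron (S ∩ T) := by
  classical
  obtain ⟨F, rfl⟩ := hS
  obtain ⟨G, rfl⟩ := hT
  refine ⟨F ∪ G, ?_⟩
  ext z
  simp only [Set.mem_inter_iff, Set.mem_ofPred_eq, Finset.mem_union, or_imp, forall_and]

theorem setOf_eq (f : V →ₗ[ℝ] ℝ) (r : ℝ) : IsPolyhedron {z | f z = r} := by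
  have := (setOf_ge f r).inter (setOf_le f r)
  rwa [← Set.ofPred_and, funext fun z => propext (le_antisymm_iff (a := f z) (b := r)).symm]
    at this

theorem biInter {ι : Type*} (s : Finset ι) {S : ι → Set V}
    (hS : ∀ i ∈ s, IsPolyhedron (S i)) : IsPolyhedron (⋂ i ∈ s, S i) := by
  classical
  induction s using Finset.induction_on with
  | empty => exact ⟨∅, by simp⟩
  | insert k s _ ih =>
    rw [Finset.set_biInter_insert]
    exact (hS k (by simp)).inter (ih fun i hi => hS i (Finset.mem_insert_of_mem hi))

theorem iInter {ι : Type*} [Fintype ι] {S : ι → Set V} (hS : ∀ i, IsPolyhedron (S i)) :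
    IsPolyhedron (⋂ i, S i) := by
  simpa using biInter Finset.univ fun i _ => hS i

theorem preimage {S : Set W} (hS : IsPolyhedron S) (L : V →ₗ[ℝ] W) : IsPolyhedron (L ⁻¹' S) := by
  classical
  obtain ⟨F, rfl⟩ := hS
  refine ⟨F.image fun f => (f.1 ∘ₗ L, f.2), ?_⟩
  ext z
  simp only [Set.mem_preimage, Set.mem_ofPred_eq, Finset.forall_mem_image, LinearMap.comp_apply]

theorem convex {S : Set V} (hS : IsPolyhedron S) : Convex ℝ S := by
  obtain ⟨F, rfl⟩ := hS
  simp only [Set.ofPred_forall]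
  exact convex_iInter₂ fun f _ => convex_halfSpace_ge f.1.isLinear f.2

/-- Finitely many linear functionals without a common zero on a polyhedron are uniformly
bounded away from zero there. -/
theorem exists_pos_le_abs {κ : Type*} [Fintype κ] {S : Set V} (hS : IsPolyhedron S)
    (c : κ → V →ₗ[ℝ] ℝ) (hc : ∀ z ∈ S, ∃ k, c k z ≠ 0) :
    ∃ ε > 0, ∀ z ∈ S, ∃ k, ε ≤ |c k z| := by
  classical
  obtain ⟨F, rfl⟩ := hS
  obtain ⟨ε, hε, H⟩ := exists_pos_forall_exists_lt_sub
    (F ∪ (Finset.univ.image (fun k => (c k, (0 : ℝ))) ∪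
      Finset.univ.image (fun k => (-c k, (0 : ℝ))))) Prod.fst Prod.snd (by
      intro z
      by_contra! hz
      obtain ⟨k, hk⟩ := hc z fun f hf => hz f (by simp [hf])
      have h₁ := hz (c k, 0) (by simp)
      have h₂ := hz (-c k, 0) (by simp)
      exact hk (le_antisymm (by simpa using h₂) h₁))
  refine ⟨ε, hε, fun z hz => ?_⟩
  obtain ⟨f, hf, hlt⟩ := H z
  simp only [Finset.mem_union, Finset.mem_image, Finset.mem_univ, true_and] at hf
  rcases hf with hf | ⟨k, rfl⟩ | ⟨k, rfl⟩
  · linarith [hz f hf]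
  · exact ⟨k, le_abs.2 (Or.inr (by simp only at hlt; linarith))⟩
  · exact ⟨k, le_abs.2 (Or.inl (by simp only [LinearMap.neg_apply] at hlt; linarith))⟩

/-- Disjoint linear images of polyhedra are at positive distance from one another. -/
theorem exists_pos_le_dist {E : Type*} [NormedAddCommGroup E] [InnerProductSpace ℝ E]
    [FiniteDimensional ℝ E] {S : Set V} {T : Set W} (hS : IsPolyhedron S) (hT : IsPolyhedron T)
    (L : V →ₗ[ℝ] E) (M : W →ₗ[ℝ] E) (hd : Disjoint (L '' S) (M '' T)) :
    ∃ ε > 0, ∀ x ∈ L '' S, ∀ y ∈ M '' T, ε ≤ dist x y := by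
  let e := stdOrthonormalBasis ℝ E
  obtain ⟨ε, hε, H⟩ := ((hS.preimage (LinearMap.fst ℝ V W)).inter
    (hT.preimage (LinearMap.snd ℝ V W))).exists_pos_le_abs
    (fun k => innerₗ E (e k) ∘ₗ (L ∘ₗ LinearMap.fst ℝ V W - M ∘ₗ LinearMap.snd ℝ V W)) (by
      rintro ⟨v, w⟩ ⟨hv, hw⟩
      by_contra! h0
      refine Set.disjoint_left.1 hd ⟨v, hv, rfl⟩ ⟨w, hw, ?_⟩
      refine InnerProductSpace.ext_inner_left_basis e.toBasis fun k => ?_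
      have : ⟪e k, L v - M w⟫ = 0 := h0 k
      rw [inner_sub_right, sub_eq_zero] at this
      simpa using this.symm)
  refine ⟨ε, hε, ?_⟩
  rintro _ ⟨v, hv, rfl⟩ _ ⟨w, hw, rfl⟩
  obtain ⟨k, hk⟩ := H (v, w) ⟨hv, hw⟩
  rw [dist_eq_norm]
  calc ε ≤ |⟪e k, L v - M w⟫| := hk
    _ ≤ ‖e k‖ * ‖L v - M w‖ := abs_real_inner_le_norm _ _
    _ = ‖L v - M w‖ := by rw [e.norm_eq_one, one_mul]

end IsPolyhedron

/-- If a set is a finite union of preconnected sets, any two of which are either intersecting or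
at positive distance, then its connected components are uniformly separated. -/
theorem exists_pos_le_infDist_connectedComponentIn {X ι : Type*} [PseudoMetricSpace X] [Finite ι]
    {P : ι → Set X} (hP : ∀ i, IsPreconnected (P i))
    (hd : ∀ i j, Disjoint (P i) (P j) → ∃ ε > 0, ∀ x ∈ P i, ∀ y ∈ P j, ε ≤ dist x y) :
    ∃ δ > 0, ∀ x ∈ ⋃ i, P i, ∀ y ∈ ⋃ i, P i,
      connectedComponentIn (⋃ i, P i) x ≠ connectedComponentIn (⋃ i, P i) y →
      δ ≤ Metric.infDist x (connectedComponentIn (⋃ i, P i) y) := by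
  have hev : ∀ᶠ δ in 𝓝[>] (0 : ℝ), ∀ i j, Disjoint (P i) (P j) →
      ∀ x ∈ P i, ∀ y ∈ P j, δ ≤ dist x y := by
    refine eventually_all.2 fun i => eventually_all.2 fun j => ?_
    by_cases hij : Disjoint (P i) (P j)
    · obtain ⟨ε, hε, H⟩ := hd i j hij
      filter_upwards [Ioo_mem_nhdsGT hε] with δ hδ _ x hx y hy
      exact hδ.2.le.trans (H x hx y hy)
    · exact Eventually.of_forall fun _ h => absurd h hij
  obtain ⟨δ, H, hδ⟩ := (hev.and self_mem_nhdsWithin).exists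
  refine ⟨δ, hδ, fun x hx y hy hxy => ?_⟩
  refine (Metric.le_infDist ⟨y, mem_connectedComponentIn hy⟩).2 fun z hz => ?_
  obtain ⟨i, hi⟩ := Set.mem_iUnion.1 hx
  obtain ⟨j, hj⟩ := Set.mem_iUnion.1 (connectedComponentIn_subset _ _ hz)
  refine H i j (by_contra fun hij => hxy ?_) x hi z hj
  obtain ⟨w, hwi, hwj⟩ := Set.not_disjoint_iff.1 hij
  have hsub : P i ∪ P j ⊆ connectedComponentIn (⋃ i, P i) x :=
    ((hP i).union w hwi hwj (hP j)).subset_connectedComponentIn (Or.inl hi)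
      (Set.union_subset (Set.subset_iUnion P i) (Set.subset_iUnion P j))
  rw [connectedComponentIn_eq hz]
  exact connectedComponentIn_eq (hsub (Or.inr hj))

section KKT

variable {E ι : Type*} [NormedAddCommGroup E] [InnerProductSpace ℝ E]

/-- Pairs of a feasible point of `b i ≤ a i x` at which the constraints in `J` are active, and of
nonnegative multipliers expressing `G x + q` through the gradients of these constraints. -/
def kktPairs (G : E →ₗ[ℝ] E) (q : E) (a : ι → E →ₗ[ℝ] ℝ) (b : ι → ℝ) (J : Finset ι) :
    Set (E × (ι → ℝ)) :=
  {p | (∀ i, b i ≤ a i p.1) ∧ (∀ i ∈ J, a i p.1 ≤ b i) ∧ (∀ i, 0 ≤ p.2 i) ∧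
    ∀ v, ⟪G p.1 + q, v⟫ = ∑ i ∈ J, p.2 i * a i v}

theorem isPolyhedron_kktPairs [FiniteDimensional ℝ E] [Fintype ι] (G : E →ₗ[ℝ] E) (q : E)
    (a : ι → E →ₗ[ℝ] ℝ) (b : ι → ℝ) (J : Finset ι) : IsPolyhedron (kktPairs G q a b J) := by
  let e := stdOrthonormalBasis ℝ E
  let fst := LinearMap.fst ℝ E (ι → ℝ)
  let snd := LinearMap.snd ℝ E (ι → ℝ)
  have hpoly := (IsPolyhedron.iInter fun i => .setOf_le (a i ∘ₗ fst) (b i)).inter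
    ((IsPolyhedron.biInter J fun i _ => .setOf_ge (a i ∘ₗ fst) (b i)).inter
    ((IsPolyhedron.iInter fun i => .setOf_le (LinearMap.proj i ∘ₗ snd) 0).inter
    (IsPolyhedron.iInter fun k => .setOf_eq
      (innerₗ E (e k) ∘ₗ G ∘ₗ fst - ∑ i ∈ J, a i (e k) • (LinearMap.proj i ∘ₗ snd))
      (-⟪e k, q⟫))))
  convert hpoly using 1
  ext ⟨x, l⟩
  have hbasis : (∀ v, ⟪G x + q, v⟫ = ∑ i ∈ J, l i * a i v) ↔
      ∀ k, ⟪e k, G x⟫ - ∑ i ∈ J, a i (e k) * l i = -⟪e k, q⟫ := by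
    have hext : (∀ v, ⟪G x + q, v⟫ = ∑ i ∈ J, l i * a i v) ↔
        innerₗ E (G x + q) = ∑ i ∈ J, l i • a i := by
      simp [LinearMap.ext_iff, inner_add_left]
    rw [hext]
    have hiff : innerₗ E (G x + q) = ∑ i ∈ J, l i • a i ↔
        ∀ k, innerₗ E (G x + q) (e k) = (∑ i ∈ J, l i • a i) (e k) :=
      ⟨fun h k => by rw [h], fun h => e.toBasis.ext fun k => by simpa using h k⟩
    rw [hiff]
    refine forall_congr' fun k => ?_
    simp only [innerₗ_apply_apply, LinearMap.sum_apply, LinearMap.smul_apply, smul_eq_mul,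
      real_inner_comm (e k), inner_add_right, mul_comm (l _)]
    constructor <;> intro h <;> linarith
  simp only [kktPairs, Set.mem_ofPred_eq, hbasis]
  simp [fst, snd]

/-- The KKT points of a polyhedrally constrained quadratic program are the projections of the
KKT pairs belonging to the various active sets. -/
theorem kkt_points_eq_iUnion [Fintype ι] (G : E →ₗ[ℝ] E) (q : E) (a : ι → E →ₗ[ℝ] ℝ)
    (b : ι → ℝ) :
    {x : E | (∀ i, b i ≤ a i x) ∧ ∀ u, (∀ i, b i ≤ a i u) → 0 ≤ ⟪G x + q, u - x⟫} =
      ⋃ J : Finset ι, LinearMap.fst ℝ E (ι → ℝ) '' kktPairs G q a b J := by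
  classical
  ext x
  simp only [Set.mem_ofPred_eq, Set.mem_iUnion, Set.mem_image]
  constructor
  · rintro ⟨hx, hopt⟩
    obtain ⟨l, hl, hsum⟩ := exists_nonneg_combination_of_forall_nonneg
      (Finset.univ.filter fun i => a i x = b i) a (innerₗ E (G x + q)) (by
        intro v hv
        have hev : ∀ᶠ t in 𝓝[>] (0 : ℝ), ∀ i, b i ≤ a i (x + t • v) := by
          refine eventually_all.2 fun i => ?_
          simp only [map_add, map_smul, smul_eq_mul]
          rcases (hx i).eq_or_lt with hi | hi
          · filter_upwards [self_mem_nhdsWithin] with t ht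
            have := mul_nonneg (le_of_lt ht) (hv i (by simp [hi]))
            linarith
          · have hcont : Tendsto (fun t : ℝ => a i x + t * a i v) (𝓝[>] 0) (𝓝 (a i x)) := by
              have : Continuous fun t : ℝ => a i x + t * a i v := by fun_prop
              simpa using (this.tendsto 0).mono_left nhdsWithin_le_nhds
            exact (hcont.eventually_const_lt hi).mono fun _ => le_of_lt
        obtain ⟨t, hfeas, ht⟩ := (hev.and self_mem_nhdsWithin).exists
        have := hopt _ hfeas
        rw [add_sub_cancel_left, real_inner_smul_right] at this
        exact nonneg_of_mul_nonneg_right this ht)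
    exact ⟨_, (x, l), ⟨hx, fun i hi => (Finset.mem_filter.1 hi).2.le, hl, hsum⟩, rfl⟩
  · rintro ⟨J, ⟨x, l⟩, ⟨hx, hJ, hl, hsum⟩, rfl⟩
    refine ⟨hx, fun u hu => ?_⟩
    refine (Finset.sum_nonneg fun i hi => mul_nonneg (hl i) ?_).trans_eq (hsum (u - x)).symm
    rw [map_sub, sub_nonneg]
    exact (hJ i hi).trans (hu i)

end KKT

/-- the connected components of the KKT point set are properly separated:
there is `δ > 0` such that a point of one component is at distance at least `δ`
from every other component. -/
theorem stmt_4 {n m : ℕ} (Q : Matrix (Fin n) (Fin n) ℝ) (hQ : Q.IsHermitian)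
    (q : EuclideanSpace ℝ (Fin n)) (A : Matrix (Fin m) (Fin n) ℝ) (b : Fin m → ℝ)
    (C : Set (EuclideanSpace ℝ (Fin n)))
    (hC : C = {x : EuclideanSpace ℝ (Fin n) | ∀ i, b i ≤ Matrix.toEuclideanLin A x i})
    (Cstar : Set (EuclideanSpace ℝ (Fin n)))
    (hCstar : Cstar = {x ∈ C | ∀ u ∈ C, 0 ≤ ⟪Matrix.toEuclideanLin Q x + q, u - x⟫}) :
    ∃ δ > 0, ∀ x ∈ Cstar, ∀ y ∈ Cstar,
      connectedComponentIn Cstar x ≠ connectedComponentIn Cstar y →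
      δ ≤ Metric.infDist x (connectedComponentIn Cstar y) := by
  have hunion := kkt_points_eq_iUnion (Matrix.toEuclideanLin Q) q
    (fun i => (EuclideanSpace.proj (𝕜 := ℝ) i).toLinearMap ∘ₗ Matrix.toEuclideanLin A) b
  have hpoly := isPolyhedron_kktPairs (Matrix.toEuclideanLin Q) q
    (fun i => (EuclideanSpace.proj (𝕜 := ℝ) i).toLinearMap ∘ₗ Matrix.toEuclideanLin A) b
  subst hC
  rw [show Cstar = _ from hCstar.trans hunion]
  exact exists_pos_le_infDist_connectedComponentIn
    (fun J => ((hpoly J).convex.linear_image _).isPreconnected)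
    (fun J K => (hpoly J).exists_pos_le_dist (hpoly K) _ _)
end

section
/- Let Q be a symmetric n×n real matrix, q ∈ ℝⁿ, f(x) = ½xᵀQx + qᵀx, C = {x ∈ ℝⁿ : Ax ≥ b}, and let C* be the KKT point set of min{f(x) : x ∈ C}. Then f is constant on each connected component of C*. -/
open RealInnerProductSpace Filter Topology

/-- If every constraint active at `x` is also active at `y`, then the segment from `y` to `x` can be
prolonged beyond `x` inside the polyhedron. -/
lemma exists_pos_forall_le_sub_smul {E ι : Type*} [AddCommGroup E] [Module ℝ E] [Finite ι]
    (L : ι → E →ₗ[ℝ] ℝ) (b : ι → ℝ) {x y : E} (hx : ∀ i, b i ≤ L i x)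
    (hxy : ∀ i, L i x = b i → L i y = b i) :
    ∃ t : ℝ, 0 < t ∧ ∀ i, b i ≤ L i (x - t • (y - x)) := by
  have h : ∀ᶠ t in 𝓝[>] (0 : ℝ), ∀ i, b i ≤ L i (x - t • (y - x)) := by
    refine eventually_all.2 fun i => ?_
    simp only [map_sub, map_smul, smul_eq_mul]
    rcases (hx i).eq_or_lt with hi | hi
    · exact Eventually.of_forall fun t => by simp [← hi, hxy i hi.symm]
    · have hc : Tendsto (fun t : ℝ => L i x - t * (L i y - L i x)) (𝓝 0) (𝓝 (L i x)) := by
        have : Continuous fun t : ℝ => L i x - t * (L i y - L i x) := by fun_prop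
        simpa using this.tendsto 0
      exact ((hc.eventually_const_lt hi).filter_mono nhdsWithin_le_nhds).mono fun _ => le_of_lt
  obtain ⟨t, ht, h0⟩ := (h.and self_mem_nhdsWithin).exists
  exact ⟨t, h0, ht⟩

/-- If `x` solves the variational inequality for `g` on a polyhedron, then `g` is orthogonal to
`y - x` for every feasible `y` at which all constraints active at `x` are active. -/
lemma inner_sub_eq_zero_of_active {E ι : Type*} [NormedAddCommGroup E] [InnerProductSpace ℝ E]
    [Finite ι] (L : ι → E →ₗ[ℝ] ℝ) (b : ι → ℝ) {g x y : E} (hx : ∀ i, b i ≤ L i x)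
    (hy : ∀ i, b i ≤ L i y) (hxy : ∀ i, L i x = b i → L i y = b i)
    (hg : ∀ u, (∀ i, b i ≤ L i u) → 0 ≤ ⟪g, u - x⟫) : ⟪g, y - x⟫ = 0 := by
  obtain ⟨t, ht, htC⟩ := exists_pos_forall_le_sub_smul L b hx hxy
  have h := hg _ htC
  rw [sub_sub_cancel_left, inner_neg_right, inner_smul_right] at h
  exact le_antisymm (nonpos_of_mul_nonpos_right (by linarith) ht) (hg y hy)

/-- The exact trapezoidal rule for quadratic functions. -/
lemma LinearMap.IsSymmetric.quadratic_sub {E : Type*} [NormedAddCommGroup E]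
    [InnerProductSpace ℝ E] {T : E →ₗ[ℝ] E} (hT : T.IsSymmetric) (q x y : E) :
    ((1 / 2) * ⟪T y, y⟫ + ⟪q, y⟫) - ((1 / 2) * ⟪T x, x⟫ + ⟪q, x⟫) =
      (1 / 2) * (⟪T x + q, y - x⟫ + ⟪T y + q, y - x⟫) := by
  have h : ⟪T x, y⟫ = ⟪T y, x⟫ := by rw [hT x y, real_inner_comm]
  simp only [inner_add_left, inner_sub_right]
  linarith

/-- the quadratic objective `f` is constant on each connected component of
the KKT point set. -/
theorem stmt_5 {n m : ℕ} (Q : Matrix (Fin n) (Fin n) ℝ) (hQ : Q.IsHermitian)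
    (q : EuclideanSpace ℝ (Fin n)) (A : Matrix (Fin m) (Fin n) ℝ) (b : Fin m → ℝ)
    (C : Set (EuclideanSpace ℝ (Fin n)))
    (hC : C = {x : EuclideanSpace ℝ (Fin n) | ∀ i, b i ≤ Matrix.toEuclideanLin A x i})
    (f : EuclideanSpace ℝ (Fin n) → ℝ)
    (hf : ∀ x, f x = (1/2) * ⟪Matrix.toEuclideanLin Q x, x⟫ + ⟪q, x⟫)
    (Cstar : Set (EuclideanSpace ℝ (Fin n)))
    (hCstar : Cstar = {x ∈ C | ∀ u ∈ C, 0 ≤ ⟪Matrix.toEuclideanLin Q x + q, u - x⟫}) :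
    ∀ x ∈ Cstar, ∀ y ∈ connectedComponentIn Cstar x, f y = f x := by
  subst hC hCstar
  set L : Fin m → EuclideanSpace ℝ (Fin n) →ₗ[ℝ] ℝ := fun i =>
    (EuclideanSpace.proj i : EuclideanSpace ℝ (Fin m) →L[ℝ] ℝ).toLinearMap ∘ₗ
      Matrix.toEuclideanLin A
  set S := {x ∈ {x : EuclideanSpace ℝ (Fin n) | ∀ i, b i ≤ Matrix.toEuclideanLin A x i} |
    ∀ u ∈ {x : EuclideanSpace ℝ (Fin n) | ∀ i, b i ≤ Matrix.toEuclideanLin A x i},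
      0 ≤ ⟪Matrix.toEuclideanLin Q x + q, u - x⟫}
  have hT : (Matrix.toEuclideanLin Q).IsSymmetric := Matrix.isSymmetric_toEuclideanLin_iff.2 hQ
  let active (x : EuclideanSpace ℝ (Fin n)) : Set (Fin m) := {i | L i x = b i}
  have hactive : ∀ x ∈ S, ∀ y ∈ S, active x = active y → f x = f y := by
    intro x hx y hy hxy
    have hiff (i : Fin m) : L i x = b i ↔ L i y = b i := Set.ext_iff.1 hxy i
    have h₁ := inner_sub_eq_zero_of_active L b hx.1 hy.1 (fun i => (hiff i).1) hx.2
    have h₂ := inner_sub_eq_zero_of_active L b hy.1 hx.1 (fun i => (hiff i).2) hy.2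
    rw [← neg_sub, inner_neg_right, neg_eq_zero] at h₂
    have h := hT.quadratic_sub q x y
    rw [h₁, h₂, ← hf, ← hf] at h
    linarith
  have hfin : (f '' S).Finite := by
    choose! g hg using fun (I : Set (Fin m)) (h : ∃ x ∈ S, active x = I) => h
    refine (Set.finite_range fun I => f (g I)).subset ?_
    rintro _ ⟨x, hx, rfl⟩
    obtain ⟨h₁, h₂⟩ := hg _ ⟨x, hx, rfl⟩
    exact ⟨active x, hactive _ h₁ _ hx h₂⟩
  have hcont : Continuous f := by
    have hQc : Continuous (Matrix.toEuclideanLin Q) := LinearMap.continuous_of_finiteDimensional _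
    rw [funext hf]
    fun_prop
  intro x hx y hy
  have hsub := connectedComponentIn_subset S x
  exact hfin.countable.isTotallyDisconnected _ (Set.image_mono hsub)
    (isPreconnected_connectedComponentIn.image f hcont.continuousOn)
    (Set.mem_image_of_mem f hy) (Set.mem_image_of_mem f (mem_connectedComponentIn hx))
end

section
/- Let Q be a symmetric n×n real matrix, q ∈ ℝⁿ, f(x) = ½xᵀQx + qᵀx, C = {x ∈ ℝⁿ : Ax ≥ b}, and let C* be the KKT point set of min{f(x) : x ∈ C}. If the segment [u, x] = {(1−t)u + tx : 0 ≤ t ≤ 1} is contained in C*, then f is constant on [u, x]. -/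
open RealInnerProductSpace Filter Topology

/-- The increment of a quadratic function along a segment is governed by its gradient at the
midpoint. -/
theorem LinearMap.IsSymmetric.quadratic_add_sub {E : Type*} [NormedAddCommGroup E]
    [InnerProductSpace ℝ E] {T : E →ₗ[ℝ] E} (hT : T.IsSymmetric) (q u v : E) :
    ((1 / 2) * ⟪T (u + v), u + v⟫ + ⟪q, u + v⟫) - ((1 / 2) * ⟪T u, u⟫ + ⟪q, u⟫) =
      ⟪T (u + (1 / 2 : ℝ) • v) + q, v⟫ := by
  have h : ⟪T v, u⟫ = ⟪T u, v⟫ := by rw [hT v u, real_inner_comm]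
  simp only [map_add, map_smul, inner_add_left, inner_add_right, real_inner_smul_left, h]
  ring

/-- A vector making nonnegative inner products with the displacements from an interior point of a
segment to its two endpoints is orthogonal to the segment. -/
theorem inner_sub_eq_zero_of_nonneg_of_nonneg {E : Type*} [NormedAddCommGroup E]
    [InnerProductSpace ℝ E] {g u x : E} {t : ℝ} (ht₀ : 0 < t) (ht₁ : t < 1)
    (hu : 0 ≤ ⟪g, u - (u + t • (x - u))⟫) (hx : 0 ≤ ⟪g, x - (u + t • (x - u))⟫) :
    ⟪g, x - u⟫ = 0 := by
  rw [show u - (u + t • (x - u)) = (-t) • (x - u) by module, real_inner_smul_right] at hu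
  rw [show x - (u + t • (x - u)) = (1 - t) • (x - u) by module, real_inner_smul_right] at hx
  exact le_antisymm (nonpos_of_mul_nonneg_right hu (neg_lt_zero.2 ht₀))
    (nonneg_of_mul_nonneg_right hx (sub_pos.2 ht₁))

/-- if a segment is contained in the KKT point set of the IQP, then the
objective `f` is constant on that segment. -/
theorem stmt_6 {n m : ℕ} (Q : Matrix (Fin n) (Fin n) ℝ) (hQ : Q.IsHermitian)
    (q : EuclideanSpace ℝ (Fin n)) (A : Matrix (Fin m) (Fin n) ℝ) (b : Fin m → ℝ)
    (C : Set (EuclideanSpace ℝ (Fin n)))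
    (hC : C = {x : EuclideanSpace ℝ (Fin n) | ∀ i, b i ≤ Matrix.toEuclideanLin A x i})
    (f : EuclideanSpace ℝ (Fin n) → ℝ)
    (hf : ∀ x, f x = (1/2) * ⟪Matrix.toEuclideanLin Q x, x⟫ + ⟪q, x⟫)
    (Cstar : Set (EuclideanSpace ℝ (Fin n)))
    (hCstar : Cstar = {x ∈ C | ∀ u ∈ C, 0 ≤ ⟪Matrix.toEuclideanLin Q x + q, u - x⟫})
    (u x : EuclideanSpace ℝ (Fin n))
    (hseg : segment ℝ u x ⊆ Cstar) :
    ∀ z ∈ segment ℝ u x, f z = f u := by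
  have hT : (Matrix.toEuclideanLin Q).IsSymmetric := Matrix.isSymmetric_toEuclideanLin_iff.2 hQ
  subst hCstar
  intro z hz
  rw [segment_eq_image'] at hz
  obtain ⟨t, ⟨ht₀, ht₁⟩, rfl⟩ := hz
  rcases ht₀.eq_or_lt with rfl | ht
  · simp
  have hmid : u + (t / 2) • (x - u) ∈ segment ℝ u x := by
    rw [segment_eq_image']
    exact ⟨t / 2, ⟨by linarith, by linarith⟩, rfl⟩
  have hkkt := (hseg hmid).2
  have hgrad := inner_sub_eq_zero_of_nonneg_of_nonneg (half_pos ht) (by linarith)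
    (hkkt u (hseg (left_mem_segment ℝ u x)).1) (hkkt x (hseg (right_mem_segment ℝ u x)).1)
  rw [← sub_eq_zero, hf, hf, hT.quadratic_add_sub, smul_smul, one_div_mul_eq_div,
    real_inner_smul_right, hgrad, mul_zero]
end

section
/- Let Q be a symmetric n×n real matrix, q ∈ ℝⁿ, f(x) = ½xᵀQx + qᵀx, and C = {x ∈ ℝⁿ : Ax ≥ b}. If x* ∈ C is a locally unique solution of min{f(x) : x ∈ C} (i.e., there is ε₀ > 0 with f(x) > f(x*) for all x ∈ (C ∩ B(x*, ε₀)) \ {x*}), then there exist μ > 0 and η > 0 such that f(x) − f(x*) ≥ η ‖x − x*‖² for every x ∈ C ∩ B(x*, μ). -/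
open RealInnerProductSpace Filter Topology

/-- Second-order expansion of a quadratic function along a ray. -/
theorem quadratic_expansion {E : Type*} [NormedAddCommGroup E] [InnerProductSpace ℝ E]
    (T : E →ₗ[ℝ] E) (hT : T.IsSymmetric) (q x d : E) (t : ℝ) :
    ((1/2) * ⟪T (x + t • d), x + t • d⟫ + ⟪q, x + t • d⟫) - ((1/2) * ⟪T x, x⟫ + ⟪q, x⟫)
      = t * ⟪T x + q, d⟫ + t ^ 2 * ((1/2) * ⟪T d, d⟫) := by
  have h : ⟪T d, x⟫ = ⟪T x, d⟫ := by rw [hT, real_inner_comm]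
  simp only [map_add, map_smul, inner_add_left, inner_add_right, real_inner_smul_left,
    real_inner_smul_right, h]
  ring

/-- Near a point of a polyhedron, the polyhedron agrees with its tangent cone: feasible points
can be dilated about the base point as long as they stay in a small ball. -/
theorem exists_ball_dilation_feasible {E ι : Type*} [NormedAddCommGroup E] [NormedSpace ℝ E]
    [FiniteDimensional ℝ E] [Finite ι] (T : ι → E →ₗ[ℝ] ℝ) (b : ι → ℝ) (x₀ : E) :
    ∃ δ > 0, ∀ x, (∀ i, b i ≤ T i x₀) → (∀ i, b i ≤ T i x) → ∀ s : ℝ, 0 ≤ s →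
      x₀ + s • (x - x₀) ∈ Metric.ball x₀ δ → ∀ i, b i ≤ T i (x₀ + s • (x - x₀)) := by
  have hev : ∀ᶠ y in 𝓝 x₀, ∀ i, b i < T i x₀ → b i < T i y := by
    refine eventually_all.2 fun i => ?_
    by_cases h : b i < T i x₀
    · filter_upwards [(T i).continuous_of_finiteDimensional.continuousAt.eventually_const_lt h]
        with y hy _ using hy
    · exact Eventually.of_forall fun y hy => absurd hy h
  obtain ⟨δ, hδ, hball⟩ := Metric.eventually_nhds_iff_ball.1 hev
  refine ⟨δ, hδ, fun x hx₀ hx s hs hy i => ?_⟩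
  rcases (hx₀ i).lt_or_eq with h | h
  · exact (hball _ hy i h).le
  · have := mul_nonneg hs (sub_nonneg.2 (hx i))
    simp only [map_add, map_smul, map_sub, smul_eq_mul, ← h]
    linarith

/-- A quadratic polynomial vanishing at zero and positive on `(0, 1]` has nonnegative slope
at zero. -/
theorem slope_nonneg_of_pos {L R : ℝ} (h : ∀ t : ℝ, 0 < t → t ≤ 1 → 0 < t * L + t ^ 2 * R) :
    0 ≤ L := by
  have hlim : Tendsto (fun t : ℝ => L + t * R) (𝓝[>] 0) (𝓝 L) := by
    have hc : Continuous fun t : ℝ => L + t * R := by fun_prop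
    simpa using (hc.tendsto 0).mono_left nhdsWithin_le_nhds
  refine ge_of_tendsto hlim ?_
  filter_upwards [Ioc_mem_nhdsGT (zero_lt_one' ℝ)] with t ht
  have := h t ht.1 ht.2
  exact (pos_of_mul_pos_right (by linarith [this] : 0 < t * (L + t * R)) ht.1.le).le

/-- quadratic growth at a locally unique solution of the IQP. -/
theorem stmt_7 {n m : ℕ} (Q : Matrix (Fin n) (Fin n) ℝ) (hQ : Q.IsHermitian)
    (q : EuclideanSpace ℝ (Fin n)) (A : Matrix (Fin m) (Fin n) ℝ) (b : Fin m → ℝ)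
    (C : Set (EuclideanSpace ℝ (Fin n)))
    (hC : C = {x : EuclideanSpace ℝ (Fin n) | ∀ i, b i ≤ Matrix.toEuclideanLin A x i})
    (f : EuclideanSpace ℝ (Fin n) → ℝ)
    (hf : ∀ x, f x = (1/2) * ⟪Matrix.toEuclideanLin Q x, x⟫ + ⟪q, x⟫)
    (xstar : EuclideanSpace ℝ (Fin n)) (hxstarC : xstar ∈ C)
    (ε₀ : ℝ) (hε₀ : 0 < ε₀)
    (hloc : ∀ x ∈ C ∩ Metric.ball xstar ε₀, x ≠ xstar → f xstar < f x) :
    ∃ μ > 0, ∃ η > 0, ∀ x ∈ C ∩ Metric.ball xstar μ,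
      η * ‖x - xstar‖^2 ≤ f x - f xstar := by
  let T : EuclideanSpace ℝ (Fin n) →ₗ[ℝ] EuclideanSpace ℝ (Fin n) := Matrix.toEuclideanLin Q
  have hT : T.IsSymmetric := Matrix.isSymmetric_toEuclideanLin_iff.2 hQ
  have hexp : ∀ d (t : ℝ), f (xstar + t • d) - f xstar
      = t * ⟪T xstar + q, d⟫ + t ^ 2 * ((1/2) * ⟪T d, d⟫) := fun d t => by
    rw [hf, hf]
    exact quadratic_expansion T hT q xstar d t
  have hTc : Continuous T := T.continuous_of_finiteDimensional
  have hfc : Continuous f := by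
    rw [funext hf]
    change Continuous fun x => (1/2) * ⟪T x, x⟫ + ⟪q, x⟫
    fun_prop
  let a : Fin m → EuclideanSpace ℝ (Fin n) →ₗ[ℝ] ℝ := fun i =>
    (EuclideanSpace.projₗ i).comp (Matrix.toEuclideanLin A)
  have hmem : ∀ x, x ∈ C ↔ ∀ i, b i ≤ a i x := fun x => by rw [hC]; rfl
  have hCclosed : IsClosed C := by
    have : C = ⋂ i, {x | b i ≤ a i x} := by ext x; simp [hmem]
    rw [this]
    exact isClosed_iInter fun i =>
      isClosed_le continuous_const (a i).continuous_of_finiteDimensional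
  obtain ⟨δ, hδ, hdil⟩ := exists_ball_dilation_feasible a b xstar
  obtain ⟨r, hr, hrlt⟩ := exists_between (lt_min hδ hε₀)
  obtain ⟨hrδ, hrε⟩ := lt_min_iff.1 hrlt
  have hfeas : ∀ x ∈ C, ∀ s : ℝ, 0 ≤ s → s * ‖x - xstar‖ ≤ r →
      xstar + s • (x - xstar) ∈ C := fun x hx s hs hsr => by
    refine (hmem _).2 (hdil x ((hmem _).1 hxstarC) ((hmem _).1 hx) s hs ?_)
    rw [mem_ball_iff_norm, add_sub_cancel_left, norm_smul, Real.norm_of_nonneg hs]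
    exact hsr.trans_lt hrδ
  have hpos : ∀ y ∈ C, y ≠ xstar → ‖y - xstar‖ ≤ r → f xstar < f y := fun y hy hne hyr =>
    hloc y ⟨hy, mem_ball_iff_norm.2 (hyr.trans_lt hrε)⟩ hne
  obtain ⟨c, hc, hcle⟩ := ((isCompact_sphere xstar r).inter_left hCclosed).exists_forall_le'
    (f := fun y => f y - f xstar) (by fun_prop) (a := 0) fun y hy =>
      sub_pos.2 (hpos y hy.1 (ne_of_mem_of_not_mem hy.2 (by simp [hr.ne]))
        (mem_sphere_iff_norm.1 hy.2).le)
  refine ⟨r, hr, c / r ^ 2, by positivity, fun x ⟨hxC, hxr⟩ => ?_⟩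
  rcases eq_or_ne x xstar with rfl | hne
  · simp
  rw [mem_ball_iff_norm] at hxr
  have hd : 0 < ‖x - xstar‖ := norm_pos_iff.2 (sub_ne_zero.2 hne)
  have hL : 0 ≤ ⟪T xstar + q, x - xstar⟫ := by
    refine slope_nonneg_of_pos (R := (1/2) * ⟪T (x - xstar), x - xstar⟫) fun t ht ht1 => ?_
    have htr : t * ‖x - xstar‖ ≤ r := by nlinarith
    rw [← hexp, sub_pos]
    refine hpos _ (hfeas x hxC t ht.le htr) ?_ ?_
    · simpa [sub_eq_zero] using ⟨ht.ne', hne⟩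
    · simpa [norm_smul, abs_of_pos ht] using htr
  have hs1 : 1 ≤ r / ‖x - xstar‖ := (one_le_div hd).2 hxr.le
  have hsr : r / ‖x - xstar‖ * ‖x - xstar‖ = r := div_mul_cancel₀ _ hd.ne'
  have hy := hcle (xstar + (r / ‖x - xstar‖) • (x - xstar))
    ⟨hfeas x hxC _ (by positivity) hsr.le, by
      rw [mem_sphere_iff_norm, add_sub_cancel_left, norm_smul,
        Real.norm_of_nonneg (by positivity), hsr]⟩
  have hx := hexp (x - xstar) 1
  rw [one_smul, add_sub_cancel] at hx
  rw [hexp] at hy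
  rw [hx]
  have hscale : c / r ^ 2 * ‖x - xstar‖ ^ 2 = c / (r / ‖x - xstar‖) ^ 2 := by field_simp
  rw [hscale, div_le_iff₀ (by positivity)]
  nlinarith [mul_nonneg (mul_nonneg (zero_le_one.trans hs1) (sub_nonneg.2 hs1)) hL]
end

section
/- Let {xᵏ} be a sequence in ℝⁿ, f : ℝⁿ → ℝ, f* ∈ ℝ, and β > 0, γ > 0, k₁ ∈ ℕ. Suppose for all k ≥ k₁: f(x^{k+1}) − f* ≤ β‖x^{k+1} − xᵏ‖² and f(x^{k+1}) ≤ f(xᵏ) − (γ/2)‖x^{k+1} − xᵏ‖², and suppose f(xᵏ) ≥ f* for all k ≥ k₁. Then f(x^{k+1}) − f* ≤ (2β/(2β + γ)) (f(xᵏ) − f*) for all k ≥ k₁; consequently f(xᵏ) − f* ≤ μ₀^{k−k₁}(f(x^{k₁}) − f*) for all k ≥ k₁, with μ₀ = 2β/(2β + γ) ∈ (0, 1). -/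
open Filter Topology

/-- an abstract linear-decrease lemma: from the per-step estimates
`f(x^{k+1}) - f* ≤ β‖x^{k+1} - xᵏ‖²` and `f(x^{k+1}) ≤ f(xᵏ) - (γ/2)‖x^{k+1} - xᵏ‖²`
(for `k ≥ k₁`, with `f(xᵏ) ≥ f*`) one gets the Q-linear decay
`f(x^{k+1}) - f* ≤ μ₀(f(xᵏ) - f*)` and hence `f(xᵏ) - f* ≤ μ₀^{k-k₁}(f(x^{k₁}) - f*)`,
where `μ₀ = 2β/(2β + γ) ∈ (0,1)`. -/
theorem stmt_16 {n : ℕ} (x : ℕ → EuclideanSpace ℝ (Fin n))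
    (f : EuclideanSpace ℝ (Fin n) → ℝ) (fstar : ℝ)
    (β γ : ℝ) (hβ : 0 < β) (hγ : 0 < γ) (k₁ : ℕ)
    (h1 : ∀ k ≥ k₁, f (x (k+1)) - fstar ≤ β * ‖x (k+1) - x k‖^2)
    (h2 : ∀ k ≥ k₁, f (x (k+1)) ≤ f (x k) - γ/2 * ‖x (k+1) - x k‖^2)
    (h3 : ∀ k ≥ k₁, fstar ≤ f (x k)) :
    (2*β/(2*β + γ)) ∈ Set.Ioo (0:ℝ) 1 ∧
    (∀ k ≥ k₁, f (x (k+1)) - fstar ≤ (2*β/(2*β + γ)) * (f (x k) - fstar)) ∧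
    (∀ k ≥ k₁, f (x k) - fstar ≤ (2*β/(2*β + γ))^(k - k₁) * (f (x k₁) - fstar)) := by
  have hpos : 0 < 2*β + γ := by positivity
  have hstep : ∀ k ≥ k₁, f (x (k+1)) - fstar ≤ (2*β/(2*β + γ)) * (f (x k) - fstar) := by
    intro k hk
    rw [div_mul_eq_mul_div, le_div_iff₀ hpos]
    have e1 := mul_le_mul_of_nonneg_left (h1 k hk) hγ.le
    have e2 := mul_le_mul_of_nonneg_left (h2 k hk) hβ.le
    linarith
  refine ⟨⟨by positivity, (div_lt_one hpos).2 (by linarith)⟩, hstep, fun k hk => ?_⟩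
  induction k, hk using Nat.le_induction with
  | base => simp
  | succ k hk ih =>
    rw [Nat.succ_sub hk, pow_succ', mul_assoc]
    exact (hstep k hk).trans (mul_le_mul_of_nonneg_left ih (by positivity))
end

section
/- Let Q be a symmetric n×n real matrix, q ∈ ℝⁿ, f(x) = ½xᵀQx + qᵀx, C = {x ∈ ℝⁿ : Ax ≥ b} nonempty, and ρ > ‖Q‖ (operator norm). Let x* ∈ C be a KKT point of min{f(x) : x ∈ C}, let y ∈ ℝⁿ, and let x′ be the unique minimizer over C of x ↦ f(x) + (ρ/2)‖x − y‖². Then ‖x′ − x*‖ ≤ (1 − ‖Q‖/ρ)⁻¹ ‖y − x*‖. -/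
open RealInnerProductSpace Filter Topology

/-- A quadratic without constant term that is nonnegative on `(0, 1]` has nonnegative slope at `0`. -/
theorem nonneg_of_forall_nonneg_mul_add_sq_mul {a c : ℝ}
    (h : ∀ t : ℝ, 0 < t → t ≤ 1 → 0 ≤ t * a + t ^ 2 * c) : 0 ≤ a := by
  by_contra! ha
  have hD : 0 < -a + |c| := by linarith [abs_nonneg c]
  have ht0 : 0 < -a / (-a + |c|) := div_pos (by linarith) hD
  have ht1 : -a / (-a + |c|) ≤ 1 := (div_le_one hD).2 (by linarith [abs_nonneg c])
  have key := h _ ht0 ht1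
  have htD : -a / (-a + |c|) * (-a + |c|) = -a := div_mul_cancel₀ _ hD.ne'
  set t := -a / (-a + |c|)
  have h1 : 0 ≤ t * (a + t * c) := by linarith
  have h2 : 0 ≤ a + t * c := nonneg_of_mul_nonneg_right h1 ht0
  have h3 : t * c ≤ t * |c| := mul_le_mul_of_nonneg_left (le_abs_self c) ht0.le
  nlinarith

section InnerProductSpace

variable {E : Type*} [NormedAddCommGroup E] [InnerProductSpace ℝ E]

/-- First-order optimality condition for a regularized quadratic over a convex set. -/
theorem Convex.inner_gradient_nonneg_of_isMin_proximal {C : Set E} (hC : Convex ℝ C)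
    {T : E →L[ℝ] E} (hT : ∀ u v, ⟪T u, v⟫ = ⟪u, T v⟫) (q y : E) (ρ : ℝ) {x : E} (hx : x ∈ C)
    (hmin : ∀ z ∈ C, (1/2) * ⟪T x, x⟫ + ⟪q, x⟫ + ρ/2 * ‖x - y‖^2 ≤
      (1/2) * ⟪T z, z⟫ + ⟪q, z⟫ + ρ/2 * ‖z - y‖^2) {u : E} (hu : u ∈ C) :
    0 ≤ ⟪T x + q + ρ • (x - y), u - x⟫ := by
  apply nonneg_of_forall_nonneg_mul_add_sq_mul
    (c := (1/2) * ⟪T (u - x), u - x⟫ + ρ/2 * ‖u - x‖^2)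
  intro t ht0 ht1
  have hz := hmin _ (hC.add_smul_sub_mem hx hu ⟨ht0.le, ht1⟩)
  generalize u - x = d at hz ⊢
  have hsymm : ⟪T d, x⟫ = ⟪T x, d⟫ := by rw [hT, real_inner_comm]
  rw [show x + t • d - y = (x - y) + t • d by abel, norm_add_sq_real, norm_smul, mul_pow,
    Real.norm_eq_abs, sq_abs] at hz
  simp only [map_add, map_smul, inner_add_left, inner_add_right, inner_smul_left,
    inner_smul_right, conj_trivial, hsymm] at hz ⊢
  linarith

/-- The proximal step of a quadratic over a convex set expands distances to a stationary point by
at most the factor `(1 - ‖T‖ / ρ)⁻¹`. -/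
theorem Convex.norm_proximal_sub_le {C : Set E} (hC : Convex ℝ C)
    {T : E →L[ℝ] E} (hT : ∀ u v, ⟪T u, v⟫ = ⟪u, T v⟫) (q y : E) {ρ : ℝ} (hρ : ‖T‖ < ρ)
    {x s : E} (hx : x ∈ C) (hs : s ∈ C) (hstat : ∀ u ∈ C, 0 ≤ ⟪T s + q, u - s⟫)
    (hmin : ∀ z ∈ C, (1/2) * ⟪T x, x⟫ + ⟪q, x⟫ + ρ/2 * ‖x - y‖^2 ≤
      (1/2) * ⟪T z, z⟫ + ⟪q, z⟫ + ρ/2 * ‖z - y‖^2) :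
    ‖x - s‖ ≤ (1 - ‖T‖ / ρ)⁻¹ * ‖y - s‖ := by
  have hρ0 : 0 < ρ := (norm_nonneg T).trans_lt hρ
  have hpos : 0 < 1 - ‖T‖ / ρ := sub_pos.2 ((div_lt_one hρ0).2 hρ)
  have hopt := hC.inner_gradient_nonneg_of_isMin_proximal hT q y ρ hx hmin hs
  have hsum : ρ * ‖x - s‖ ^ 2 ≤ -⟪T (x - s), x - s⟫ + ρ * ⟪y - s, x - s⟫ := by
    have hkkt := hstat x hx
    rw [← real_inner_self_eq_norm_sq]
    simp only [map_sub, inner_add_left, inner_sub_left, inner_sub_right, inner_smul_left,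
      conj_trivial] at hopt hkkt ⊢
    linarith
  have hTd : -⟪T (x - s), x - s⟫ ≤ ‖T‖ * ‖x - s‖ * ‖x - s‖ :=
    (neg_le_abs _).trans ((abs_real_inner_le_norm _ _).trans
      (mul_le_mul_of_nonneg_right (T.le_opNorm _) (norm_nonneg _)))
  have hyd : ρ * ⟪y - s, x - s⟫ ≤ ρ * (‖y - s‖ * ‖x - s‖) :=
    mul_le_mul_of_nonneg_left (real_inner_le_norm _ _) hρ0.le
  rw [inv_mul_eq_div, le_div_iff₀ hpos]
  rcases (norm_nonneg (x - s)).eq_or_lt with h0 | h0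
  · rw [← h0, zero_mul]
    exact norm_nonneg _
  · have hmul : ‖x - s‖ * (‖x - s‖ * (ρ - ‖T‖)) ≤ ‖x - s‖ * (ρ * ‖y - s‖) := by linarith
    have hle := le_of_mul_le_mul_left hmul h0
    refine le_of_mul_le_mul_left ?_ hρ0
    calc ρ * (‖x - s‖ * (1 - ‖T‖ / ρ)) = ‖x - s‖ * (ρ - ‖T‖) := by field_simp
      _ ≤ ρ * ‖y - s‖ := hle

end InnerProductSpace

/-- nonexpansiveness-type estimate around a KKT point for the proximal step
of Algorithm B when `ρ > ‖Q‖`: `‖x′ - x*‖ ≤ (1 - ‖Q‖/ρ)⁻¹ ‖y - x*‖`. -/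
theorem stmt_18 {n m : ℕ} (Q : Matrix (Fin n) (Fin n) ℝ) (hQ : Q.IsHermitian)
    (q : EuclideanSpace ℝ (Fin n)) (A : Matrix (Fin m) (Fin n) ℝ) (b : Fin m → ℝ)
    (C : Set (EuclideanSpace ℝ (Fin n)))
    (hC : C = {x : EuclideanSpace ℝ (Fin n) | ∀ i, b i ≤ Matrix.toEuclideanLin A x i})
    (hCne : C.Nonempty)
    (f : EuclideanSpace ℝ (Fin n) → ℝ)
    (hf : ∀ x, f x = (1/2) * ⟪Matrix.toEuclideanLin Q x, x⟫ + ⟪q, x⟫)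
    (ρ : ℝ) (hρ : ‖Matrix.toEuclideanCLM (𝕜 := ℝ) Q‖ < ρ)
    (xstar : EuclideanSpace ℝ (Fin n)) (hxstarC : xstar ∈ C)
    (hKKT : ∀ u ∈ C, 0 ≤ ⟪Matrix.toEuclideanLin Q xstar + q, u - xstar⟫)
    (y : EuclideanSpace ℝ (Fin n))
    (x' : EuclideanSpace ℝ (Fin n)) (hx'C : x' ∈ C)
    -- `x′` is the (unique) minimizer over `C` of `z ↦ f z + (ρ/2) ‖z - y‖²`
    (hx'min : ∀ z ∈ C, f x' + ρ/2 * ‖x' - y‖^2 ≤ f z + ρ/2 * ‖z - y‖^2) :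
    ‖x' - xstar‖ ≤ (1 - ‖Matrix.toEuclideanCLM (𝕜 := ℝ) Q‖/ρ)⁻¹ * ‖y - xstar‖ := by
  have hconv : Convex ℝ C := by
    rw [hC, Set.ofPred_forall]
    refine convex_iInter fun i => convex_halfSpace_ge (f := fun x => Matrix.toEuclideanLin A x i)
      ⟨fun _ _ => ?_, fun _ _ => ?_⟩ (b i) <;> simp
  have hsymm : ∀ u v, ⟪Matrix.toEuclideanCLM (𝕜 := ℝ) Q u, v⟫ =
      ⟪u, Matrix.toEuclideanCLM (𝕜 := ℝ) Q v⟫ :=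
    Matrix.isSymmetric_toEuclideanLin_iff.2 hQ
  simp only [hf] at hx'min
  exact hconv.norm_proximal_sub_le hsymm q y hρ hx'C hxstarC hKKT hx'min
end
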